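/- arXiv:2207.14728 — 4 statements merged into one kernel-verified Lean document; each statement's English description precedes it below -/
import Mathlib

section
/- Let Δ ≥ 4 be a natural number, let G be a connected locally finite Δ-regular simple graph that is not a complete graph, and let r be a vertex of G. Then there exists an edge colouring c of G with two colours, red and blue, such that: (i) the only automorphism of G that fixes r and preserves c is the identity; (ii) the set of vertices all of whose incident edges are coloured red is either the singleton {r} or a two-element set {r, x} where x is a neighbour of r; and (iii) if this set has two elements, then for every natural number k with 1 ≤ k ≤ Δ, the vertex r has a neighbour with exactly k incident red edges. -/
open SimpleGraph

/-- The number of red edges incident to a vertex `v`, for an edge colouring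
`c : G.edgeSet → Bool`, where `true` stands for red and `false` for blue. -/
noncomputable def redCount {V : Type*} (G : SimpleGraph V) (c : G.edgeSet → Bool) (v : V) : ℕ :=
  Set.ncard {u : V | ∃ h : G.Adj v u, c ⟨s(v, u), (G.mem_edgeSet).mpr h⟩ = true}

/-- The set of vertices all of whose incident edges are red (`true` = red). -/
def allRedVertices {V : Type*} (G : SimpleGraph V) (c : G.edgeSet → Bool) : Set V :=
  {v : V | ∀ e : G.edgeSet, v ∈ (e : Sym2 V) → c e = true}

set_option linter.unusedSectionVars false

namespace RootedColouring

open scoped Classical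
open Finset

variable {V : Type*} {G : SimpleGraph V}

/-- The colourings `c` and `c'` agree on all edges meeting `P`. -/
def Agree (c c' : Sym2 V → Bool) (P : Set V) : Prop :=
  ∀ p ∈ P, ∀ u, c' s(p, u) = c s(p, u)

/-- `φ` fixes `P` pointwise and preserves the colours of the edges meeting `P`. -/
def Stab (G : SimpleGraph V) (c : Sym2 V → Bool) (P : Set V) (φ : G ≃g G) : Prop :=
  ∀ p ∈ P, φ p = p ∧ ∀ u, G.Adj p u → c s(p, φ u) = c s(p, u)

/-- The orbit of `y` under the automorphisms satisfying `Stab G c P`. -/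
def orbit (G : SimpleGraph V) (c : Sym2 V → Bool) (P : Set V) (y : V) : Set V :=
  {z | ∃ φ : G ≃g G, Stab G c P φ ∧ φ y = z}

/-- Whatever the colours of the edges avoiding `P` are, every colour preserving automorphism
fixing `r` fixes `P` pointwise. -/
def Rigid (G : SimpleGraph V) (r : V) (c : Sym2 V → Bool) (P : Set V) : Prop :=
  ∀ c', Agree c c' P → ∀ φ : G ≃g G, φ r = r →
    (∀ u v, G.Adj u v → c' s(φ u, φ v) = c' s(u, v)) → ∀ p ∈ P, φ p = p

theorem Stab.refl (c : Sym2 V → Bool) (P : Set V) : Stab G c P (RelIso.refl _) :=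
  fun _ _ => ⟨rfl, fun _ _ => rfl⟩

theorem Stab.symm {c : Sym2 V → Bool} {P : Set V} {φ : G ≃g G} (h : Stab G c P φ) :
    Stab G c P φ.symm := by
  intro p hp
  have h1 : φ.symm p = p := by
    rw [RelIso.symm_apply_eq]; exact (h p hp).1.symm
  refine ⟨h1, fun u hu => ?_⟩
  have := (h p hp).2 (φ.symm u) (by
    rw [← φ.map_adj_iff, (h p hp).1, RelIso.apply_symm_apply]; exact hu)
  rw [RelIso.apply_symm_apply] at this
  exact this.symm

theorem Stab.trans {c : Sym2 V → Bool} {P : Set V} {φ ψ : G ≃g G} (h : Stab G c P φ)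
    (h' : Stab G c P ψ) : Stab G c P (φ.trans ψ) := by
  intro p hp
  refine ⟨by simp [(h p hp).1, (h' p hp).1], fun u hu => ?_⟩
  have hu' : G.Adj p (φ u) := by
    have := φ.map_adj_iff.2 hu
    rwa [(h p hp).1] at this
  have := (h' p hp).2 _ hu'
  simpa [(h p hp).2 u hu] using this

theorem Stab.mono {c c' : Sym2 V → Bool} {P P' : Set V} (hP : P ⊆ P') (hc : Agree c c' P)
    {φ : G ≃g G} (h : Stab G c' P' φ) : Stab G c P φ := by
  intro p hp
  refine ⟨(h p (hP hp)).1, fun u hu => ?_⟩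
  rw [← hc p hp, ← hc p hp]
  exact (h p (hP hp)).2 u hu

theorem Stab.notMem {c : Sym2 V → Bool} {P : Set V} {φ : G ≃g G} (h : Stab G c P φ) {y : V}
    (hy : y ∉ P) : φ y ∉ P := by
  intro hP
  have := (h _ hP).1
  exact hy (φ.injective this ▸ hP)

theorem mem_orbit_self (c : Sym2 V → Bool) (P : Set V) (y : V) : y ∈ orbit G c P y :=
  ⟨_, Stab.refl c P, rfl⟩

theorem orbit_symm {c : Sym2 V → Bool} {P : Set V} {y z : V} (h : z ∈ orbit G c P y) :
    y ∈ orbit G c P z := by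
  obtain ⟨φ, hφ, rfl⟩ := h
  exact ⟨φ.symm, hφ.symm, by simp⟩

theorem orbit_trans {c : Sym2 V → Bool} {P : Set V} {x y z : V} (h : y ∈ orbit G c P x)
    (h' : z ∈ orbit G c P y) : z ∈ orbit G c P x := by
  obtain ⟨φ, hφ, rfl⟩ := h
  obtain ⟨ψ, hψ, rfl⟩ := h'
  exact ⟨φ.trans ψ, hφ.trans hψ, rfl⟩

theorem orbit_eq {c : Sym2 V → Bool} {P : Set V} {y z : V} (h : z ∈ orbit G c P y) :
    orbit G c P z = orbit G c P y :=
  Set.ext fun _ => ⟨fun h' => orbit_trans h h', fun h' => orbit_trans (orbit_symm h) h'⟩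

theorem orbit_mono {c c' : Sym2 V → Bool} {P P' : Set V} (hP : P ⊆ P') (hc : Agree c c' P)
    (y : V) : orbit G c' P' y ⊆ orbit G c P y := by
  rintro z ⟨φ, hφ, rfl⟩
  exact ⟨φ, hφ.mono hP hc, rfl⟩

theorem notMem_of_mem_orbit {c : Sym2 V → Bool} {P : Set V} {y z : V} (h : z ∈ orbit G c P y)
    (hy : y ∉ P) : z ∉ P := by
  obtain ⟨φ, hφ, rfl⟩ := h
  exact hφ.notMem hy

/-- A set of vertices mapped into itself by the automorphisms satisfying `Stab G c P`. -/
def Invariant (G : SimpleGraph V) (c : Sym2 V → Bool) (P W : Set V) : Prop :=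
  ∀ φ : G ≃g G, Stab G c P φ → ∀ z ∈ W, φ z ∈ W

theorem invariant_orbit (c : Sym2 V → Bool) (P : Set V) (y : V) :
    Invariant G c P (orbit G c P y) :=
  fun φ hφ _ hz => orbit_trans hz ⟨φ, hφ, rfl⟩

theorem invariant_compl (c : Sym2 V → Bool) (P : Set V) : Invariant G c P Pᶜ :=
  fun _ hφ _ hz => hφ.notMem hz

theorem Invariant.mem_iff {c : Sym2 V → Bool} {P W : Set V} (hW : Invariant G c P W)
    {φ : G ≃g G} (hφ : Stab G c P φ) {z : V} : φ z ∈ W ↔ z ∈ W :=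
  ⟨fun h => by simpa using hW _ hφ.symm _ h, hW φ hφ z⟩

variable [G.LocallyFinite]

/-- The number of neighbours of `y` outside `P`. -/
noncomputable def outdeg (G : SimpleGraph V) [G.LocallyFinite] (P : Set V) (y : V) : ℕ :=
  #{u ∈ G.neighborFinset y | u ∉ P}

theorem card_filter_neighbor_map {φ : G ≃g G} {p q : V → Prop} [DecidablePred p]
    [DecidablePred q] {y : V}
    (h : ∀ u, G.Adj y u → (q (φ u) ↔ p u)) :
    #{u ∈ G.neighborFinset (φ y) | q u} = #{u ∈ G.neighborFinset y | p u} := by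
  symm
  refine Finset.card_nbij φ ?_ φ.injective.injOn ?_
  · intro u hu
    simp only [coe_filter, mem_neighborFinset, Set.mem_ofPred_eq] at hu ⊢
    exact ⟨φ.map_adj_iff.2 hu.1, (h u hu.1).2 hu.2⟩
  · intro u hu
    simp only [coe_filter, mem_neighborFinset, Set.mem_ofPred_eq] at hu
    refine ⟨φ.symm u, ?_, by simp⟩
    have h1 : G.Adj y (φ.symm u) := by
      rw [← φ.map_adj_iff]; simpa using hu.1
    have h2 := h _ h1
    simp only [RelIso.apply_symm_apply] at h2
    simp [h1, ← h2, hu.2]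

theorem outdeg_eq {c : Sym2 V → Bool} {P : Set V} {y z : V} (h : z ∈ orbit G c P y) :
    outdeg G P z = outdeg G P y := by
  obtain ⟨φ, hφ, rfl⟩ := h
  unfold outdeg
  exact card_filter_neighbor_map (p := (· ∉ P)) (q := (· ∉ P)) fun u _ =>
    (invariant_compl c P).mem_iff hφ (z := u)

theorem rigid_union {r : V} {c c' : Sym2 V → Bool} {P W : Set V} {C : Finset V}
    (h : Rigid G r c P) (hc : Agree c c' P) (hC : Invariant G c P C) (hW : Invariant G c P W)
    (hinj : Set.InjOn (fun x => #{y ∈ G.neighborFinset x | y ∈ W ∧ c' s(x, y) = true}) C) :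
    Rigid G r c' (P ∪ C) := by
  intro d hd φ hr hφ
  have hdP : Agree c d P := fun p hp u => (hd p (Or.inl hp) u).trans (hc p hp u)
  have hfix := h d hdP φ hr hφ
  have hS : Stab G c P φ := by
    intro p hp
    refine ⟨hfix p hp, fun u hu => ?_⟩
    rw [← hdP p hp, ← hdP p hp, ← hφ p u hu, hfix p hp]
  rintro p (hp | hp)
  · exact hfix p hp
  · refine hinj (hC φ hS p hp) hp ?_
    refine card_filter_neighbor_map (G := G) (p := fun y => y ∈ W ∧ c' s(p, y) = true)
      (q := fun y => y ∈ W ∧ c' s(φ p, y) = true) fun u hu => ?_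
    rw [hW.mem_iff hS, ← hd _ (Or.inr (hC φ hS p hp)), hφ p u hu, hd p (Or.inr hp)]

/-- An extendable partial colouring: `c` is decided on the edges meeting `P`, the vertices of `P`
outside `P₀` have a blue edge, and orbits outside `P` are small. -/
structure Good (G : SimpleGraph V) [G.LocallyFinite] (r : V) (P₀ P : Set V) (c : Sym2 V → Bool) :
    Prop where
  root : r ∈ P
  rigid : Rigid G r c P
  size : ∀ y ∉ P, (∃ p ∈ P, G.Adj p y) → (orbit G c P y).ncard ≤ max 1 (outdeg G P y)
  blue : ∀ y ∉ P, (∃ p ∈ P, G.Adj p y ∧ c s(p, y) = false) ∨ 1 ≤ outdeg G P y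
  blue_mem : ∀ y ∈ P, y ∉ P₀ → ∃ u, G.Adj y u ∧ c s(y, u) = false

theorem outdeg_union {P : Set V} {C : Finset V} (hC : Disjoint P (C : Set V)) (y : V) :
    outdeg G (P ∪ C) y + #{x ∈ C | G.Adj x y} = outdeg G P y := by
  unfold outdeg
  have : ({x ∈ C | G.Adj x y} : Finset V) =
      {u ∈ ({u ∈ G.neighborFinset y | u ∉ P} : Finset V) | u ∈ C} := by
    ext u
    simp only [mem_filter, mem_neighborFinset]
    refine ⟨fun h => ⟨⟨h.2.symm, fun hP => Set.disjoint_left.1 hC hP h.1⟩, h.1⟩,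
      fun h => ⟨h.2, h.1.1.symm⟩⟩
  rw [this, ← Finset.card_filter_add_card_filter_not (s := {u ∈ G.neighborFinset y | u ∉ P})
    (fun u => u ∈ C), add_comm]
  congr 2
  ext u
  simp only [mem_filter, mem_neighborFinset, Set.mem_union, mem_coe, not_or]
  tauto

theorem exists_extension (c : Sym2 V → Bool) {P : Set V} {C : Finset V}
    (hC : Disjoint P (C : Set V)) {ρ : V → V → Prop}
    (hρ : ∀ x ∈ C, ∀ y ∈ C, G.Adj x y → ρ x y → ρ y x) :
    ∃ c' : Sym2 V → Bool, Agree c c' P ∧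
      ∀ x ∈ C, ∀ y ∉ P, G.Adj x y → (c' s(x, y) = true ↔ ρ x y) := by
  refine ⟨fun e => if ∃ p ∈ P, p ∈ e then c e else decide (∃ x ∈ C, ∃ y, e = s(x, y) ∧ ρ x y),
    ?_, ?_⟩
  · intro p hp u
    exact if_pos ⟨p, hp, by simp⟩
  · intro x hx y hy hxy
    have hxP : x ∉ P := fun h => Set.disjoint_left.1 hC h hx
    have : ¬ ∃ p ∈ P, p ∈ s(x, y) := by
      rintro ⟨p, hp, hp'⟩
      rcases Sym2.mem_iff.1 hp' with rfl | rfl <;> contradiction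
    simp only [this, if_false, decide_eq_true_eq]
    constructor
    · rintro ⟨a, ha, b, hab, h⟩
      rcases Sym2.eq_iff.1 hab with ⟨rfl, rfl⟩ | ⟨rfl, rfl⟩
      · exact h
      · exact hρ _ ha _ hx hxy.symm h
    · exact fun h => ⟨x, hx, y, rfl, h⟩

theorem finite_of_forall_adj {S : Set V} {x : V} (h : ∀ y ∈ S, G.Adj x y) : S.Finite :=
  (G.neighborFinset x).finite_toSet.subset fun y hy => by simpa using h y hy

/-- Colouring the edges between an invariant set `C` and the complement of `P` according to `ρ`. -/
theorem good_union {r : V} {P₀ P W : Set V} {c : Sym2 V → Bool} {C : Finset V}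
    (hC : Disjoint P (C : Set V)) (hinv : Invariant G c P C)
    (hroot : r ∈ P) (hrigid : Rigid G r c P)
    (hsize : ∀ y ∉ P, y ∉ C → (∀ x ∈ C, ¬ G.Adj x y) → (∃ p ∈ P, G.Adj p y) →
      (orbit G c P y).ncard ≤ max 1 (outdeg G P y))
    (hblue : ∀ y ∉ P, y ∉ C → (∀ x ∈ C, ¬ G.Adj x y) →
      (∃ p ∈ P, G.Adj p y ∧ c s(p, y) = false) ∨ 1 ≤ outdeg G P y)
    (hblue_mem : ∀ y ∈ P, y ∉ P₀ → ∃ u, G.Adj y u ∧ c s(y, u) = false)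
    {ρ : V → V → Prop} (hρ : ∀ x ∈ C, ∀ y ∈ C, G.Adj x y → ρ x y → ρ y x)
    (hW : Invariant G c P W) (hWP : Disjoint P W)
    (hinj : Set.InjOn (fun x => #{y ∈ G.neighborFinset x | y ∈ W ∧ ρ x y}) C)
    (hpiece : ∀ y ∉ P, y ∉ C → (∃ x ∈ C, G.Adj x y) →
      {z ∈ orbit G c P y | ∀ x ∈ C, (G.Adj x z ↔ G.Adj x y) ∧
        (G.Adj x y → (ρ x z ↔ ρ x y))}.ncard ≤
        max 1 (outdeg G P y - #{x ∈ C | G.Adj x y}))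
    (hpblue : ∀ y ∉ P, y ∉ C → (∃ x ∈ C, G.Adj x y) →
      (∃ x ∈ C, G.Adj x y ∧ ¬ ρ x y) ∨ #{x ∈ C | G.Adj x y} < outdeg G P y)
    (hCblue : ∀ x ∈ C, x ∉ P₀ → (∃ p ∈ P, G.Adj p x ∧ c s(p, x) = false) ∨
      ∃ y ∉ P, G.Adj x y ∧ ¬ ρ x y) :
    ∃ c' : Sym2 V → Bool, Agree c c' P ∧ Good G r P₀ (P ∪ C) c' ∧
      ∀ x ∈ C, ∀ y ∉ P, G.Adj x y → (c' s(x, y) = true ↔ ρ x y) := by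
  obtain ⟨c', hc, hc'⟩ := exists_extension c hC hρ
  have hCP : ∀ x ∈ C, x ∉ P := fun x hx h => Set.disjoint_left.1 hC h hx
  have hout := outdeg_union (G := G) hC
  refine ⟨c', hc, ⟨Or.inl hroot, ?_, ?_, ?_, ?_⟩, hc'⟩
  · refine rigid_union hrigid hc hinv hW ?_
    intro x hx x' hx' h
    refine hinj hx hx' ?_
    have key : ∀ x ∈ C, #{y ∈ G.neighborFinset x | y ∈ W ∧ c' s(x, y) = true} =
        #{y ∈ G.neighborFinset x | y ∈ W ∧ ρ x y} := by
      intro x hx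
      congr 1
      refine filter_congr fun y hy => and_congr_right fun hyW => ?_
      exact hc' x hx y (fun h => Set.disjoint_left.1 hWP h hyW) (by simpa using hy)
    simpa only [key x hx, key x' hx'] using h
  · intro y hy hadj
    simp only [Set.mem_union, mem_coe, not_or] at hy
    by_cases hyC : ∃ x ∈ C, G.Adj x y
    · have : outdeg G (P ∪ C) y = outdeg G P y - #{x ∈ C | G.Adj x y} := by
        have := hout y; omega
      rw [this]
      refine le_trans (Set.ncard_le_ncard ?_ ?_) (hpiece y hy.1 hy.2 hyC)
      · rintro z ⟨φ, hφ, rfl⟩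
        refine ⟨⟨φ, hφ.mono Set.subset_union_left hc, rfl⟩, fun x hx => ?_⟩
        have hfx := hφ x (Or.inr hx)
        have h1 : G.Adj x (φ y) ↔ G.Adj x y := by
          have := φ.map_adj_iff (v := x) (w := y)
          rwa [hfx.1] at this
        refine ⟨h1, fun h => ?_⟩
        rw [← hc' x hx _ ((hφ.mono Set.subset_union_left hc).notMem hy.1) (h1.2 h),
          ← hc' x hx y hy.1 h, hfx.2 y h]
      · obtain ⟨x, hx, hxy⟩ := hyC
        exact finite_of_forall_adj (G := G) (x := x) fun z hz => ((hz.2 x hx).1).2 hxy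
    · push Not at hyC
      have h0 : #{x ∈ C | G.Adj x y} = 0 := by
        rw [card_eq_zero, filter_eq_empty_iff]; exact fun x hx => hyC x hx
      have h1 : outdeg G (P ∪ C) y = outdeg G P y := by have := hout y; omega
      obtain ⟨p, hp, hpy⟩ := hadj
      have hpP : p ∈ P := hp.resolve_right fun h => hyC p h hpy
      rw [h1]
      refine le_trans (Set.ncard_le_ncard (orbit_mono Set.subset_union_left hc y) ?_)
        (hsize y hy.1 hy.2 hyC ⟨p, hpP, hpy⟩)
      refine finite_of_forall_adj (G := G) (x := p) ?_
      rintro z ⟨φ, hφ, rfl⟩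
      rw [← (hφ p hpP).1, φ.map_adj_iff]
      exact hpy
  · intro y hy
    simp only [Set.mem_union, mem_coe, not_or] at hy
    have := hout y
    by_cases hyC : ∃ x ∈ C, G.Adj x y
    · rcases hpblue y hy.1 hy.2 hyC with ⟨x, hx, hxy, hρ⟩ | h
      · exact Or.inl ⟨x, Or.inr hx, hxy, by
          rw [← hc' x hx y hy.1 hxy] at hρ; simpa using hρ⟩
      · right; omega
    · push Not at hyC
      have h0 : #{x ∈ C | G.Adj x y} = 0 := by
        rw [card_eq_zero, filter_eq_empty_iff]; exact fun x hx => hyC x hx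
      rcases hblue y hy.1 hy.2 hyC with ⟨p, hp, hpy, h⟩ | h
      · exact Or.inl ⟨p, Or.inl hp, hpy, by rw [hc p hp, h]⟩
      · right; omega
  · rintro y (hy | hy) hy0
    · obtain ⟨u, hu, h⟩ := hblue_mem y hy hy0
      exact ⟨u, hu, by rw [hc y hy, h]⟩
    · rcases hCblue y hy hy0 with ⟨p, hp, hpy, h⟩ | ⟨u, hu, hyu, h⟩
      · exact ⟨p, hpy.symm, by rw [Sym2.eq_swap, hc p hp, h]⟩
      · exact ⟨u, hyu, by rw [← hc' y hy u hu hyu] at h; simpa using h⟩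

theorem Agree.trans {c c' c'' : Sym2 V → Bool} {P P' : Set V} (h : Agree c c' P)
    (h' : Agree c' c'' P') (hP : P ⊆ P') : Agree c c'' P :=
  fun p hp u => (h' p (hP hp) u).trans (h p hp u)

theorem orbit_finite {c : Sym2 V → Bool} {P : Set V} {p y : V} (hp : p ∈ P) (hpy : G.Adj p y) :
    (orbit G c P y).Finite := by
  refine finite_of_forall_adj (G := G) (x := p) ?_
  rintro z ⟨φ, hφ, rfl⟩
  rw [← (hφ p hp).1, φ.map_adj_iff]
  exact hpy

theorem good_iUnion {r : V} {P₀ : Set V} {ι : Type*} [Nonempty ι] {P : ι → Set V}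
    {c : ι → Sym2 V → Bool} (hG : ∀ i, Good G r P₀ (P i) (c i))
    (hdir : ∀ i j, (P i ⊆ P j ∧ Agree (c i) (c j) (P i)) ∨ (P j ⊆ P i ∧ Agree (c j) (c i) (P j))) :
    ∃ c', (∀ i, Agree (c i) c' (P i)) ∧ Good G r P₀ (⋃ i, P i) c' := by
  let c' : Sym2 V → Bool := fun e =>
    if h : ∃ i, ∃ p ∈ P i, p ∈ e then c h.choose e else true
  have hc' : ∀ i, Agree (c i) c' (P i) := by
    intro i p hp u
    have h : ∃ i, ∃ q ∈ P i, q ∈ s(p, u) := ⟨i, p, hp, by simp⟩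
    have h1 : c' s(p, u) = c h.choose s(p, u) := dif_pos h
    rw [h1]
    obtain ⟨q, hq, hqe⟩ := h.choose_spec
    rcases hdir i h.choose with h2 | h2
    · exact h2.2 p hp u
    · obtain ⟨v, hv⟩ := Sym2.mem_iff_exists.1 hqe
      have h3 := h2.2 q hq v
      rw [← hv] at h3
      exact h3.symm
  have hloc : ∀ y, ∃ i, ∀ u, G.Adj y u → (u ∈ ⋃ i, P i) → u ∈ P i := by
    intro y
    have := DirectedOn.exists_mem_subset_of_finset_subset_biUnion (f := P) (c := Set.univ)
      Set.univ_nonempty (by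
        intro i _ j _
        rcases hdir i j with h | h
        · exact ⟨j, trivial, h.1, subset_rfl⟩
        · exact ⟨i, trivial, subset_rfl, h.1⟩)
      (s := {u ∈ G.neighborFinset y | u ∈ ⋃ i, P i}) (by
        intro u hu
        simpa using (by simpa using hu : G.Adj y u ∧ ∃ i, u ∈ P i).2)
    obtain ⟨i, -, hi⟩ := this
    exact ⟨i, fun u hu hu' => hi (by simpa [hu] using hu')⟩
  have hsub : ∀ i, P i ⊆ ⋃ i, P i := Set.subset_iUnion P
  have hout : ∀ y i, (∀ u, G.Adj y u → (u ∈ ⋃ i, P i) → u ∈ P i) →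
      outdeg G (⋃ i, P i) y = outdeg G (P i) y := by
    intro y i hi
    unfold outdeg
    congr 1
    refine filter_congr fun u hu => not_congr ⟨hi u (by simpa using hu), fun h => hsub i h⟩
  refine ⟨c', hc', ⟨?_, ?_, ?_, ?_, ?_⟩⟩
  · exact hsub (Classical.arbitrary ι) (hG _).root
  · intro d hd φ hr hφ p hp
    obtain ⟨i, hi⟩ := Set.mem_iUnion.1 hp
    exact (hG i).rigid d ((hc' i).trans hd (hsub i)) φ hr hφ p hi
  · rintro y hy ⟨p, hp, hpy⟩
    obtain ⟨i, hi⟩ := hloc y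
    rw [hout y i hi]
    have hpi := hi p hpy.symm hp
    exact (Set.ncard_le_ncard (orbit_mono (hsub i) (hc' i) y) (orbit_finite hpi hpy)).trans
      ((hG i).size y (fun h => hy (hsub i h)) ⟨p, hpi, hpy⟩)
  · intro y hy
    obtain ⟨i, hi⟩ := hloc y
    rw [hout y i hi]
    refine ((hG i).blue y (fun h => hy (hsub i h))).imp_left ?_
    rintro ⟨p, hp, hpy, h⟩
    exact ⟨p, hsub i hp, hpy, by rw [hc' i p hp, h]⟩
  · intro y hy hy0
    obtain ⟨i, hi⟩ := Set.mem_iUnion.1 hy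
    obtain ⟨u, hu, h⟩ := (hG i).blue_mem y hi hy0
    exact ⟨u, hu, by rw [hc' i y hi, h]⟩

theorem exists_good_univ {r : V} {P₀ P₁ : Set V} {c₁ : Sym2 V → Bool} (h₁ : Good G r P₀ P₁ c₁)
    (step : ∀ P c, Good G r P₀ P c → P ≠ Set.univ →
      ∃ P' c', P ⊂ P' ∧ Agree c c' P ∧ Good G r P₀ P' c') :
    ∃ c, Agree c₁ c P₁ ∧ Good G r P₀ Set.univ c := by
  let T := {x : Set V × (Sym2 V → Bool) // Good G r P₀ x.1 x.2 ∧ P₁ ⊆ x.1 ∧ Agree c₁ x.2 P₁}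
  let R : T → T → Prop := fun x y => x.1.1 ⊆ y.1.1 ∧ Agree x.1.2 y.1.2 x.1.1
  obtain ⟨m, hm⟩ := exists_maximal_of_chains_bounded (r := R) (by
    intro S hS
    rcases S.eq_empty_or_nonempty with rfl | hne
    · exact ⟨⟨(P₁, c₁), h₁, subset_rfl, fun _ _ _ => rfl⟩, by simp⟩
    · have := hne.to_subtype
      obtain ⟨c', hc', hg⟩ := good_iUnion (G := G) (r := r) (P₀ := P₀)
        (P := fun i : S => i.1.1.1) (c := fun i : S => i.1.1.2) (fun i => i.1.2.1) (by
          intro i j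
          by_cases hij : i = j
          · subst hij; exact Or.inl ⟨subset_rfl, fun _ _ _ => rfl⟩
          · exact hS i.2 j.2 (fun h => hij (Subtype.ext h)))
      obtain ⟨s, hs⟩ := hne
      refine ⟨⟨(_, c'), hg, s.2.2.1.trans (Set.subset_iUnion (fun i : S => i.1.1.1) ⟨s, hs⟩),
        s.2.2.2.trans (hc' ⟨s, hs⟩) s.2.2.1⟩, fun a ha => ⟨?_, hc' ⟨a, ha⟩⟩⟩
      exact Set.subset_iUnion (fun i : S => i.1.1.1) ⟨a, ha⟩)
    (fun {a b d} h h' => ⟨h.1.trans h'.1, h.2.trans h'.2 h.1⟩)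
  obtain ⟨⟨P, c⟩, hg, hsub, hag⟩ := m
  by_cases hP : P = Set.univ
  · subst hP
    exact ⟨c, hag, hg⟩
  · obtain ⟨P', c', hss, hag', hg'⟩ := step P c hg hP
    have := hm ⟨(P', c'), hg', hsub.trans hss.1, hag.trans hag' hsub⟩ ⟨hss.1, hag'⟩
    exact absurd this.1 hss.2

/-- A finite orbit of the automorphisms satisfying `Stab G c P`. -/
def IsOrbit (G : SimpleGraph V) (c : Sym2 V → Bool) (P : Set V) (C : Finset V) : Prop :=
  C.Nonempty ∧ ∀ x ∈ C, orbit G c P x = C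

theorem IsOrbit.invariant {c : Sym2 V → Bool} {P : Set V} {C : Finset V}
    (h : IsOrbit G c P C) : Invariant G c P C := by
  intro φ hφ z hz
  rw [← h.2 z hz]
  exact ⟨φ, hφ, rfl⟩

theorem IsOrbit.exists_map {c : Sym2 V → Bool} {P : Set V} {C : Finset V}
    (h : IsOrbit G c P C) {x y : V} (hx : x ∈ C) (hy : y ∈ C) :
    ∃ φ : G ≃g G, Stab G c P φ ∧ φ x = y := by
  have : y ∈ orbit G c P x := by rw [h.2 x hx]; exact hy
  exact this

theorem isOrbit_of_finite {c : Sym2 V → Bool} {P : Set V} {y : V}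
    (h : (orbit G c P y).Finite) : IsOrbit G c P h.toFinset :=
  ⟨⟨y, by simpa using mem_orbit_self c P y⟩, fun x hx => by
    rw [Set.Finite.coe_toFinset]; exact orbit_eq (by simpa using hx)⟩

theorem IsOrbit.ncard_eq {c : Sym2 V → Bool} {P : Set V} {C : Finset V}
    (h : IsOrbit G c P C) {x : V} (hx : x ∈ C) : (orbit G c P x).ncard = #C := by
  rw [h.2 x hx, Set.ncard_coe_finset]

/-- The neighbours of `y` in `C`. -/
noncomputable def nbs (G : SimpleGraph V) (C : Finset V) (y : V) : Finset V :=
  {x ∈ C | G.Adj x y}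

@[simp]
theorem mem_nbs {C : Finset V} {x y : V} : x ∈ nbs G C y ↔ x ∈ C ∧ G.Adj x y := by
  simp [nbs]

theorem nbs_map {c : Sym2 V → Bool} {P : Set V} {C : Finset V} (hC : Invariant G c P C)
    {φ : G ≃g G} (hφ : Stab G c P φ) (y : V) :
    nbs G C (φ y) = (nbs G C y).image φ := by
  ext x
  simp only [mem_nbs, mem_image]
  constructor
  · rintro ⟨hx, hxy⟩
    refine ⟨φ.symm x, ⟨hC _ hφ.symm _ hx, ?_⟩, by simp⟩
    rw [← φ.map_adj_iff]; simpa using hxy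
  · rintro ⟨z, ⟨hz, hzy⟩, rfl⟩
    exact ⟨hC φ hφ z hz, φ.map_adj_iff.2 hzy⟩

theorem nbs_inj_map {c : Sym2 V → Bool} {P : Set V} {C : Finset V} (hC : Invariant G c P C)
    {φ : G ≃g G} (hφ : Stab G c P φ) (y z : V) :
    nbs G C (φ y) = nbs G C (φ z) ↔ nbs G C y = nbs G C z := by
  rw [nbs_map hC hφ, nbs_map hC hφ, (image_injective φ.injective).eq_iff]

/-- Numerical data of the bipartite graph between two orbits. -/
structure Incidence (G : SimpleGraph V) (C D : Finset V) (s k e β : ℕ) : Prop where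
  card_nbs : ∀ z ∈ D, #(nbs G C z) = β
  card_block : ∀ z ∈ D, #{z' ∈ D | nbs G C z' = nbs G C z} = e
  card_image : #(D.image (nbs G C)) = s
  card_eq : #D = s * e
  card_mem : ∀ x ∈ C, #{j ∈ D.image (nbs G C) | x ∈ j} = k
  card_adj : ∀ x ∈ C, #{z ∈ D | G.Adj x z} = k * e
  mul_eq : #C * k = s * β

theorem exists_incidence {c : Sym2 V → Bool} {P : Set V} {C D : Finset V}
    (hC : IsOrbit G c P C) (hD : IsOrbit G c P D) : ∃ s k e β, Incidence G C D s k e β := by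
  obtain ⟨x₀, hx₀⟩ := hC.1
  obtain ⟨y₀, hy₀⟩ := hD.1
  have hβ : ∀ z ∈ D, #(nbs G C z) = #(nbs G C y₀) := by
    intro z hz
    obtain ⟨φ, hφ, rfl⟩ := hD.exists_map hy₀ hz
    rw [nbs_map hC.invariant hφ, card_image_of_injective _ φ.injective]
  have he : ∀ z ∈ D, #{z' ∈ D | nbs G C z' = nbs G C z} =
      #{z' ∈ D | nbs G C z' = nbs G C y₀} := by
    intro z hz
    obtain ⟨φ, hφ, rfl⟩ := hD.exists_map hy₀ hz
    rw [← card_image_of_injective ({z' ∈ D | nbs G C z' = nbs G C y₀}) φ.injective]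
    congr 1
    ext u
    simp only [mem_filter, mem_image]
    constructor
    · rintro ⟨hu, h⟩
      refine ⟨φ.symm u, ⟨hD.invariant _ hφ.symm _ hu, ?_⟩, by simp⟩
      rw [← nbs_inj_map hC.invariant hφ]; simpa using h
    · rintro ⟨v, ⟨hv, h⟩, rfl⟩
      exact ⟨hD.invariant _ hφ _ hv, (nbs_inj_map hC.invariant hφ _ _).2 h⟩
  have hk : ∀ x ∈ C, #{j ∈ D.image (nbs G C) | x ∈ j} = #{j ∈ D.image (nbs G C) | x₀ ∈ j} := by
    intro x hx
    obtain ⟨φ, hφ, rfl⟩ := hC.exists_map hx₀ hx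
    rw [← card_image_of_injective ({j ∈ D.image (nbs G C) | x₀ ∈ j})
      (image_injective φ.injective)]
    congr 1
    ext j
    simp only [mem_filter, mem_image]
    constructor
    · rintro ⟨⟨v, hv, rfl⟩, h⟩
      refine ⟨nbs G C (φ.symm v), ⟨⟨_, hD.invariant _ hφ.symm _ hv, rfl⟩, ?_⟩, ?_⟩
      · simp only [mem_nbs] at h ⊢
        refine ⟨hx₀, ?_⟩
        rw [← φ.map_adj_iff]; simpa using h.2
      · rw [← nbs_map hC.invariant hφ]; simp
    · rintro ⟨_, ⟨⟨v, hv, rfl⟩, h⟩, rfl⟩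
      refine ⟨⟨φ v, hD.invariant _ hφ _ hv, nbs_map hC.invariant hφ v⟩, ?_⟩
      exact mem_image_of_mem _ h
  refine ⟨_, _, _, _, hβ, he, rfl, ?_, hk, ?_, ?_⟩
  · rw [card_eq_sum_card_image (nbs G C) D]
    refine sum_const_nat fun j hj => ?_
    obtain ⟨z, hz, rfl⟩ := mem_image.1 hj
    exact he z hz
  · intro x hx
    rw [← hk x hx]
    rw [card_eq_sum_card_fiberwise (f := nbs G C) (t := {j ∈ D.image (nbs G C) | x ∈ j})
      (s := {z ∈ D | G.Adj x z})]
    · rw [sum_const_nat (m := #{z' ∈ D | nbs G C z' = nbs G C y₀})]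
      intro j hj
      simp only [mem_filter, mem_image] at hj
      obtain ⟨⟨z, hz, rfl⟩, hxj⟩ := hj
      rw [← he z hz, filter_filter]
      congr 1
      refine filter_congr fun u _ => ⟨fun h => h.2, fun h => ⟨?_, h⟩⟩
      have : x ∈ nbs G C u := h ▸ hxj
      exact (mem_nbs.1 this).2
    · intro z hz
      simp only [coe_filter, Set.mem_ofPred_eq, mem_image] at hz ⊢
      exact ⟨⟨z, hz.1, rfl⟩, mem_nbs.2 ⟨hx, hz.2⟩⟩
  · refine card_mul_eq_card_mul (r := fun x j => x ∈ j) (s := C) (t := D.image (nbs G C))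
      (fun x hx => hk x hx) ?_
    intro j hj
    obtain ⟨z, hz, rfl⟩ := mem_image.1 hj
    rw [← hβ z hz]
    congr 1
    ext x
    simp [bipartiteBelow]

/-- Arithmetic of a pair of orbits that are incompletely joined. -/
theorem Incidence.pos {C D : Finset V} {s k e β : ℕ} (h : Incidence G C D s k e β)
    (hC : C.Nonempty) (hD : D.Nonempty) (hβ : 1 ≤ β) : 1 ≤ s ∧ 1 ≤ k ∧ 1 ≤ e := by
  have hm := hC.card_pos
  have hn := hD.card_pos
  rw [h.card_eq] at hn
  have hs : 1 ≤ s := Nat.pos_of_mul_pos_right hn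
  refine ⟨hs, ?_, Nat.pos_of_mul_pos_left hn⟩
  have := h.mul_eq
  have h2 : 0 < #C * k := by rw [this]; positivity
  exact Nat.pos_of_mul_pos_left h2

theorem lt_of_lt {m s k β : ℕ} (hmul : m * k = s * β) (hs : 1 ≤ s) (hβ : β < m) : k < s := by
  by_contra! h
  nlinarith

theorem add_le_of_nonfull {m s k e β : ℕ} (hmul : m * k = s * β) (hk : k < s)
    (hmn : m ≤ s * e) : e + β ≤ s * e := by
  have hs : 0 < s := by omega
  obtain ⟨t, rfl⟩ : ∃ t, s = t + 1 := ⟨s - 1, by omega⟩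
  have h1 : (t + 1) * β ≤ (t + 1) * (e * t) := by
    rw [← hmul]
    calc m * k ≤ ((t + 1) * e) * t := Nat.mul_le_mul hmn (by omega)
      _ = _ := by ring
  have := Nat.le_of_mul_le_mul_left h1 hs
  nlinarith

theorem bad_arith {Δ m s k β : ℕ} (hmul : m * k = s * β) (hk : 1 ≤ k) (hks : k < s)
    (hβ : β ≤ Δ) (hm : m ≤ Δ) : s * Δ ≤ m + s * (k * (Δ - β)) := by
  obtain ⟨δ, rfl⟩ := Nat.exists_eq_add_of_le hβ
  obtain ⟨t, rfl⟩ := Nat.exists_eq_add_of_le hk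
  simp only [Nat.add_sub_cancel_left]
  have h1 : t * ((t + 2) * m) ≤ t * (s * (β + δ)) :=
    Nat.mul_le_mul_left _ (Nat.mul_le_mul (by omega) hm)
  nlinarith

theorem bad_half {Δ m s w : ℕ} (h : s * Δ ≤ m + s * w) (hs : 2 ≤ s) (hm : m ≤ Δ) :
    Δ ≤ 2 * w := by
  by_contra! hlt
  have h1 : s * Δ ≤ Δ + s * w := h.trans (by omega)
  have : s * (2 * w + 1) ≤ s * Δ := Nat.mul_le_mul_left _ hlt
  nlinarith

theorem bad_le {Δ m s w : ℕ} (h : s * Δ ≤ m + s * w) (hs : 1 ≤ s) : Δ ≤ m + w := by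
  by_contra! hlt
  nlinarith

/-- `ℓ` restricts to a bijection from `C` to `{0, …, #C - 1}`. -/
structure Label (C : Finset V) (ℓ : V → ℕ) : Prop where
  inj : Set.InjOn ℓ C
  lt : ∀ x ∈ C, ℓ x < #C

theorem Label.image {C : Finset V} {ℓ : V → ℕ} (h : Label C ℓ) : C.image ℓ = range #C := by
  refine eq_of_subset_of_card_le ?_ ?_
  · intro i hi
    obtain ⟨x, hx, rfl⟩ := mem_image.1 hi
    exact mem_range.2 (h.lt x hx)
  · rw [card_range, card_image_of_injOn h.inj]

theorem Label.exists_eq {C : Finset V} {ℓ : V → ℕ} (h : Label C ℓ) {i : ℕ} (hi : i < #C) :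
    ∃ x ∈ C, ℓ x = i := by
  rw [← mem_range, ← h.image] at hi
  simpa using hi

theorem Label.card_filter {C : Finset V} {ℓ : V → ℕ} (h : Label C ℓ) (p : ℕ → Prop)
    [DecidablePred p] :
    #{x ∈ C | p (ℓ x)} = #{i ∈ range #C | p i} := by
  rw [← h.image, filter_image, card_image_of_injOn (h.inj.mono (coe_subset.2 (filter_subset _ _)))]

theorem Label.card_ge {C : Finset V} {ℓ : V → ℕ} (h : Label C ℓ) {i : ℕ} (hi : i ≤ #C) :
    #{x ∈ C | #C ≤ i + ℓ x} = i := by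
  rw [h.card_filter (fun j => #C ≤ i + j)]
  have : ({j ∈ range #C | #C ≤ i + j} : Finset ℕ) = Ico (#C - i) #C := by
    ext j; simp only [mem_filter, mem_range, mem_Ico]; omega
  rw [this, Nat.card_Ico]; omega

theorem exists_label {C s : Finset V} (hs : s ⊆ C) {f : V → ℕ} (hf : Set.InjOn f s)
    (hlt : ∀ x ∈ s, f x < #C) : ∃ ℓ, Label C ℓ ∧ ∀ x ∈ s, ℓ x = f x := by
  obtain ⟨g, hg⟩ := Finset.exists_equiv_extend_of_card_eq (α := C) (β := ℕ) (t := range #C)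
    (by simp) (s := s.subtype (· ∈ C)) (f := fun x => f x) (by
      intro i hi
      simp only [mem_image, mem_subtype] at hi
      obtain ⟨x, hx, rfl⟩ := hi
      exact mem_range.2 (hlt x hx))
    (by
      intro x hx y hy h
      simp only [mem_coe, mem_subtype] at hx hy
      exact Subtype.ext (hf hx hy h))
  refine ⟨fun x => if h : x ∈ C then g ⟨x, h⟩ else 0, ⟨?_, ?_⟩, ?_⟩
  · intro x hx y hy h
    simp only [mem_coe] at hx hy
    simp only [hx, hy, dite_true] at h
    simpa using g.injective (Subtype.ext h)
  · intro x hx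
    simp only [hx, dite_true]
    exact mem_range.1 (g ⟨x, hx⟩).2
  · intro x hx
    simp only [hs hx, dite_true]
    exact hg ⟨x, hs hx⟩ (by simpa using hx)

theorem exists_index (C : Finset V) : ∃ ℓ, Label C ℓ := by
  obtain ⟨ℓ, h, -⟩ := exists_label (C := C) (s := ∅) (f := fun _ => 0) (by simp) (by simp) (by simp)
  exact ⟨ℓ, h⟩

/-- The number of red edges inside `C` at `x`, when `x x'` is red iff `#C ≤ ℓ x + ℓ x'`. -/
noncomputable def innerRed (G : SimpleGraph V) (C : Finset V) (ℓ : V → ℕ) (x : V) : ℕ :=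
  #{x' ∈ C | G.Adj x x' ∧ #C ≤ ℓ x + ℓ x'}

theorem innerRed_le {C : Finset V} {ℓ : V → ℕ} (h : Label C ℓ) {x : V} (hx : x ∈ C) :
    innerRed G C ℓ x ≤ ℓ x := by
  conv_rhs => rw [← h.card_ge (h.lt x hx).le]
  exact card_le_card fun y hy => by
    simp only [mem_filter] at hy ⊢; exact ⟨hy.1, hy.2.2⟩

theorem innerRed_le_card {C : Finset V} {ℓ : V → ℕ} (x : V) :
    innerRed G C ℓ x ≤ #(nbs G C x) :=
  card_le_card fun y hy => by
    simp only [mem_filter, mem_nbs] at hy ⊢; exact ⟨hy.1, hy.2.1.symm⟩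

theorem card_nonadj {C : Finset V} (x : V) :
    #(nbs G C x) + #{x' ∈ C | ¬ G.Adj x x'} = #C := by
  rw [← card_filter_add_card_filter_not (s := C) (fun x' => G.Adj x x')]
  simp only [nbs, G.adj_comm x]

theorem innerRed_add {C : Finset V} {ℓ : V → ℕ} (h : Label C ℓ) {x : V} (hx : x ∈ C) :
    ℓ x = innerRed G C ℓ x + #{x' ∈ C | ¬ G.Adj x x' ∧ #C ≤ ℓ x + ℓ x'} := by
  conv_lhs => rw [← h.card_ge (h.lt x hx).le]
  rw [← card_filter_add_card_filter_not (s := {y ∈ C | #C ≤ ℓ x + ℓ y}) (fun x' => G.Adj x x')]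
  simp only [innerRed, filter_filter, and_comm]

theorem le_innerRed {C : Finset V} {ℓ : V → ℕ} (h : Label C ℓ) {x : V} (hx : x ∈ C) :
    ℓ x + #(nbs G C x) ≤ innerRed G C ℓ x + #C := by
  have h1 := innerRed_add (G := G) h hx
  have h2 := card_nonadj (G := G) (C := C) x
  have h3 : #{x' ∈ C | ¬ G.Adj x x' ∧ #C ≤ ℓ x + ℓ x'} ≤ #{x' ∈ C | ¬ G.Adj x x'} :=
    card_le_card fun y hy => by
      simp only [mem_filter] at hy ⊢; exact ⟨hy.1, hy.2.1⟩
  omega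

theorem lt_innerRed {C : Finset V} {ℓ : V → ℕ} (h : Label C ℓ) {x : V} (hx : x ∈ C)
    (hstar : ∃ x' ∈ C, ¬ G.Adj x x' ∧ ℓ x + ℓ x' < #C) :
    ℓ x + #(nbs G C x) < innerRed G C ℓ x + #C := by
  have h1 := innerRed_add (G := G) h hx
  have h2 := card_nonadj (G := G) (C := C) x
  obtain ⟨z, hz, hxz, hlt⟩ := hstar
  have h3 : #{x' ∈ C | ¬ G.Adj x x' ∧ #C ≤ ℓ x + ℓ x'} < #{x' ∈ C | ¬ G.Adj x x'} := by
    refine card_lt_card ⟨fun y hy => ?_, fun hsub => ?_⟩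
    · simp only [mem_filter] at hy ⊢; exact ⟨hy.1, hy.2.1⟩
    · have := hsub (mem_filter.2 ⟨hz, hxz⟩)
      simp only [mem_filter] at this
      omega
  omega

/-- The neighbours of `x` outside `P ∪ C`. -/
noncomputable def outside (G : SimpleGraph V) [G.LocallyFinite] (P : Set V) (C : Finset V)
    (x : V) : Finset V :=
  {y ∈ G.neighborFinset x | y ∉ P ∧ y ∉ C}

theorem mem_outside {P : Set V} {C : Finset V} {x y : V} :
    y ∈ outside G P C x ↔ G.Adj x y ∧ y ∉ P ∧ y ∉ C := by
  simp [outside]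

theorem card_outside {P : Set V} {C : Finset V} (hC : Disjoint P (C : Set V)) (x : V) :
    #(outside G P C x) + #(nbs G C x) = outdeg G P x := by
  rw [← outdeg_union hC]
  congr 2
  ext y
  simp only [mem_filter, mem_outside, mem_neighborFinset, Set.mem_union, mem_coe, not_or]

/-- The labelled colouring: `x x'` inside `C` is red iff `#C ≤ ℓ x + ℓ x'`, and the red edges
from `x ∈ C` to the outside of `P ∪ C` go to `S x`. -/
theorem good_union_label {r : V} {P₀ P : Set V} {c : Sym2 V → Bool} {C : Finset V}
    (hC : Disjoint P (C : Set V)) (hinv : Invariant G c P C)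
    (hroot : r ∈ P) (hrigid : Rigid G r c P)
    (hsize : ∀ y ∉ P, y ∉ C → (∀ x ∈ C, ¬ G.Adj x y) → (∃ p ∈ P, G.Adj p y) →
      (orbit G c P y).ncard ≤ max 1 (outdeg G P y))
    (hblue : ∀ y ∉ P, y ∉ C → (∀ x ∈ C, ¬ G.Adj x y) →
      (∃ p ∈ P, G.Adj p y ∧ c s(p, y) = false) ∨ 1 ≤ outdeg G P y)
    (hblue_mem : ∀ y ∈ P, y ∉ P₀ → ∃ u, G.Adj y u ∧ c s(y, u) = false)
    {ℓ : V → ℕ} (hℓ : Label C ℓ) {τ : ℕ} {S : V → Finset V}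
    (hS : ∀ x ∈ C, S x ⊆ outside G P C x)
    (hcard : ∀ x ∈ C, innerRed G C ℓ x + #(S x) = ℓ x + τ)
    (hpiece : ∀ y ∉ P, y ∉ C → (∃ x ∈ C, G.Adj x y) →
      {z ∈ orbit G c P y | nbs G C z = nbs G C y ∧
        ∀ x ∈ C, G.Adj x y → (z ∈ S x ↔ y ∈ S x)}.ncard ≤
        max 1 (outdeg G P y - #(nbs G C y)))
    (hpblue : ∀ y ∉ P, y ∉ C → (∃ x ∈ C, G.Adj x y) →
      (∃ x ∈ C, G.Adj x y ∧ y ∉ S x) ∨ #(nbs G C y) < outdeg G P y)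
    (hCblue : ∀ x ∈ C, x ∉ P₀ → ℓ x + τ < outdeg G P x) :
    ∃ c' : Sym2 V → Bool, Agree c c' P ∧ Good G r P₀ (P ∪ C) c' ∧
      ∀ x ∈ C, #{y ∈ G.neighborFinset x | y ∉ P ∧ c' s(x, y) = true} = ℓ x + τ := by
  obtain ⟨ρ, hρ⟩ : ∃ ρ : V → V → Prop, ∀ x y,
    ρ x y ↔ (y ∈ C ∧ #C ≤ ℓ x + ℓ y) ∨ (y ∉ C ∧ y ∈ S x) := ⟨_, fun _ _ => Iff.rfl⟩
  obtain ⟨W, hW⟩ : ∃ W, W = Pᶜ := ⟨_, rfl⟩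
  have hmemW : ∀ y, y ∈ W ↔ y ∉ P := fun y => by rw [hW, Set.mem_compl_iff]
  have hcount : ∀ x ∈ C, #{y ∈ G.neighborFinset x | y ∈ W ∧ ρ x y} = ℓ x + τ := by
    intro x hx
    rw [← hcard x hx, innerRed, ← card_union_of_disjoint]
    · congr 1
      ext y
      simp only [mem_filter, mem_union, mem_neighborFinset, hρ, hmemW]
      constructor
      · rintro ⟨h1, h2, h3 | h3⟩
        · exact Or.inl ⟨h3.1, h1, h3.2⟩
        · exact Or.inr h3.2
      · rintro (h1 | h1)
        · exact ⟨h1.2.1, fun h => Set.disjoint_left.1 hC h h1.1, Or.inl ⟨h1.1, h1.2.2⟩⟩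
        · have := mem_outside.1 (hS x hx h1)
          exact ⟨this.1, this.2.1, Or.inr ⟨this.2.2, h1⟩⟩
    · rw [Finset.disjoint_left]
      intro y hy hy'
      exact (mem_outside.1 (hS x hx hy')).2.2 (mem_filter.1 hy).1
  refine Exists.imp ?_ (good_union (ρ := ρ) (W := W) (P₀ := P₀) hC hinv hroot hrigid hsize
    hblue hblue_mem ?_ (hW ▸ invariant_compl c P) (hW ▸ disjoint_compl_right) ?_ ?_ ?_ ?_)
  · rintro c' ⟨hc, hg, hc'⟩
    refine ⟨hc, hg, fun x hx => ?_⟩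
    rw [← hcount x hx]
    congr 1
    refine filter_congr fun y hy => (and_congr_right fun hyP => ?_).trans
      (and_congr_left' (hmemW y).symm)
    exact hc' x hx y hyP (by simpa using hy)
  · intro x hx y hy _ hxy
    rw [hρ] at hxy ⊢
    rcases hxy with h | h
    · exact Or.inl ⟨hx, by omega⟩
    · exact absurd hy h.1
  · intro x hx y hy h
    simp only [hcount x hx, hcount y hy] at h
    exact hℓ.inj hx hy (by omega)
  · intro y hyP hyC hy
    refine le_trans (Set.ncard_le_ncard ?_ ?_) (hpiece y hyP hyC hy)
    · rintro z ⟨hz, h⟩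
      refine ⟨hz, ?_, fun x hx hxy => ?_⟩
      · ext x
        simp only [mem_nbs]
        exact and_congr_right fun hx => (h x hx).1
      · have hzC : z ∉ C := by
          intro hz'
          obtain ⟨φ, hφ, rfl⟩ := hz
          exact hyC ((hinv.mem_iff hφ).1 hz')
        simpa [hρ, hyC, hzC] using (h x hx).2 hxy
    · obtain ⟨x, hx, hxy⟩ := hy
      refine finite_of_forall_adj (G := G) (x := x) fun z hz => ?_
      have : x ∈ nbs G C z := by rw [hz.2.1]; simp [hx, hxy]
      exact (mem_nbs.1 this).2
  · intro y hyP hyC hy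
    refine (hpblue y hyP hyC hy).imp_left ?_
    rintro ⟨x, hx, hxy, h⟩
    exact ⟨x, hx, hxy, by simp [hρ, hyC, h]⟩
  · intro x hx hx0
    right
    by_contra! hcon
    have h1 := hCblue x hx hx0
    rw [← hcount x hx] at h1
    refine h1.not_ge (card_le_card fun y hy => ?_)
    simp only [mem_filter, mem_neighborFinset, hmemW] at hy ⊢
    exact ⟨hy.1, hy.2, hcon y hy.2 hy.1⟩

/-- A partial colouring decided at `P`, together with an orbit `C` to be treated next. -/
structure Pre (G : SimpleGraph V) [G.LocallyFinite] (r : V) (P₀ P : Set V) (c : Sym2 V → Bool)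
    (C : Finset V) : Prop where
  disj : Disjoint P (C : Set V)
  isOrbit : IsOrbit G c P C
  root : r ∈ P
  rigid : Rigid G r c P
  size : ∀ y ∉ P, y ∉ C → (∀ x ∈ C, ¬ G.Adj x y) → (∃ p ∈ P, G.Adj p y) →
    (orbit G c P y).ncard ≤ max 1 (outdeg G P y)
  blue : ∀ y ∉ P, y ∉ C → (∀ x ∈ C, ¬ G.Adj x y) →
    (∃ p ∈ P, G.Adj p y ∧ c s(p, y) = false) ∨ 1 ≤ outdeg G P y
  blue_mem : ∀ y ∈ P, y ∉ P₀ → ∃ u, G.Adj y u ∧ c s(y, u) = false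

/-- Choosing a subset of the neighbours of `x` in `D` which meets every block of `D` in neither
too few nor too many vertices. -/
theorem exists_balanced {C D : Finset V} {s k e β hi : ℕ} (hI : Incidence G C D s k e β)
    (he : e ≤ 2 * hi) (hie : hi ≤ e) {x : V} (hx : x ∈ C) {n : ℕ} (hn : k * (e - hi) ≤ n)
    (hn' : n ≤ k * hi) : ∃ S ⊆ ({z ∈ D | G.Adj x z} : Finset V), #S = n ∧
      ∀ y ∈ D, G.Adj x y → #{z ∈ D | nbs G C z = nbs G C y ∧ (z ∈ S ↔ y ∈ S)} ≤ hi := by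
  have hex : ∀ j ∈ D.image (nbs G C), ∃ L U : Finset V, L ⊆ U ∧
      U ⊆ ({z ∈ D | nbs G C z = j} : Finset V) ∧ #L = e - hi ∧ #U = hi := by
    intro j hj
    obtain ⟨z, hz, rfl⟩ := mem_image.1 hj
    obtain ⟨U, hU, hU'⟩ := exists_subset_card_eq (n := hi) (hie.trans (hI.card_block z hz).ge)
    obtain ⟨L, hL, hL'⟩ := exists_subset_card_eq (s := U) (n := e - hi) (by omega)
    exact ⟨L, U, hL, hU, hL', hU'⟩
  choose! L U hLU hU hLc hUc using hex
  set Jx := ({j ∈ D.image (nbs G C) | x ∈ j} : Finset (Finset V)) with hJx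
  have hJ : ∀ j ∈ Jx, j ∈ D.image (nbs G C) := fun j hj => (mem_filter.1 hj).1
  have hdisj : ∀ T : Finset V → Finset V, (∀ j ∈ Jx, T j ⊆ U j) →
      (Jx : Set (Finset V)).PairwiseDisjoint T := by
    intro T hT i hi j hj hij
    rw [Function.onFun, Finset.disjoint_left]
    intro z hz hz'
    have h1 := (mem_filter.1 (hU i (hJ i hi) (hT i hi hz))).2
    have h2 := (mem_filter.1 (hU j (hJ j hj) (hT j hj hz'))).2
    exact hij (h1.symm.trans h2)
  have hcL : #(Jx.biUnion L) = k * (e - hi) := by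
    rw [card_biUnion (hdisj L fun j hj => hLU j (hJ j hj)), ← hI.card_mem x hx]
    exact sum_const_nat fun j hj => hLc j (hJ j hj)
  have hcU : #(Jx.biUnion U) = k * hi := by
    rw [card_biUnion (hdisj U fun j hj => subset_rfl), ← hI.card_mem x hx]
    exact sum_const_nat fun j hj => hUc j (hJ j hj)
  obtain ⟨S, hLS, hSU, hS⟩ := exists_subsuperset_card_eq
    (biUnion_mono fun j hj => hLU j (hJ j hj)) (hcL.le.trans hn) (hn'.trans hcU.ge)
  refine ⟨S, ?_, hS, ?_⟩
  · intro z hz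
    obtain ⟨j, hj, hzj⟩ := mem_biUnion.1 (hSU hz)
    have h1 := mem_filter.1 (hU j (hJ j hj) hzj)
    have h2 := (mem_filter.1 hj).2
    rw [← h1.2, mem_nbs] at h2
    exact mem_filter.2 ⟨h1.1, h2.2⟩
  · intro y hy hxy
    have hyJ : nbs G C y ∈ Jx :=
      mem_filter.2 ⟨mem_image_of_mem _ hy, mem_nbs.2 ⟨hx, hxy⟩⟩
    by_cases hyS : y ∈ S
    · rw [← hUc _ (hJ _ hyJ)]
      refine card_le_card fun z hz => ?_
      simp only [mem_filter, hyS, iff_true] at hz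
      obtain ⟨j, hj, hzj⟩ := mem_biUnion.1 (hSU hz.2.2)
      have h1 := (mem_filter.1 (hU j (hJ j hj) hzj)).2
      rw [← hz.2.1, h1]
      exact hzj
    · have h1 : ({z ∈ D | nbs G C z = nbs G C y ∧ (z ∈ S ↔ y ∈ S)} : Finset V) ⊆
          ({z ∈ D | nbs G C z = nbs G C y} : Finset V) \ L (nbs G C y) := by
        intro z hz
        simp only [mem_filter, hyS, iff_false, mem_sdiff] at hz ⊢
        exact ⟨⟨hz.1, hz.2.1⟩, fun h => hz.2.2 (hLS (mem_biUnion.2 ⟨_, hyJ, h⟩))⟩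
      refine (card_le_card h1).trans ?_
      rw [card_sdiff_of_subset ((hLU _ (hJ _ hyJ)).trans (hU _ (hJ _ hyJ))), hI.card_block y hy,
        hLc _ (hJ _ hyJ)]
      omega

/-- The labelled colouring, where the orbit `D` is split by the vertices of `Q ⊆ C`. -/
theorem Pre.exists_good_label {r : V} {P₀ P : Set V} {c : Sym2 V → Bool} {C D Q : Finset V}
    (h : Pre G r P₀ P c C) {ℓ : V → ℕ} (hℓ : Label C ℓ) {τ s k e β hi : ℕ}
    (hfeas : ∀ x ∈ C, ℓ x + τ ≤ innerRed G C ℓ x + #(outside G P C x))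
    (hI : Incidence G C D s k e β) (hD : ∀ y ∈ D, y ∉ P ∧ y ∉ C ∧ orbit G c P y = D)
    (he : e ≤ 2 * hi) (hie : hi ≤ e) (hQ : Q ⊆ C) (hhit : ∀ y ∈ D, ∃ x ∈ Q, G.Adj x y)
    (hwin : ∀ x ∈ Q, innerRed G C ℓ x + k * (e - hi) ≤ ℓ x + τ ∧
      ℓ x + τ ≤ innerRed G C ℓ x + k * hi)
    (hhi : ∀ y ∈ D, hi ≤ max 1 (outdeg G P y - #(nbs G C y)))
    (hblock : ∀ y ∉ P, y ∉ C → y ∉ D → (∃ x ∈ C, G.Adj x y) →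
      {z ∈ orbit G c P y | nbs G C z = nbs G C y}.ncard ≤ max 1 (outdeg G P y - #(nbs G C y)))
    (hpblue : ∀ y ∉ P, y ∉ C → (∃ x ∈ C, G.Adj x y) →
      (∃ x ∈ C, G.Adj x y ∧ ℓ x + τ = 0) ∨ #(nbs G C y) < outdeg G P y)
    (hCblue : ∀ x ∈ C, x ∉ P₀ → ℓ x + τ < outdeg G P x) :
    ∃ c' : Sym2 V → Bool, Agree c c' P ∧ Good G r P₀ (P ∪ C) c' ∧
      ∀ x ∈ C, #{y ∈ G.neighborFinset x | y ∉ P ∧ c' s(x, y) = true} = ℓ x + τ := by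
  have hle : ∀ x ∈ C, innerRed G C ℓ x ≤ ℓ x + τ := fun x hx =>
    (innerRed_le hℓ hx).trans (Nat.le_add_right _ _)
  have hex : ∀ x ∈ C, ∃ S ⊆ outside G P C x, innerRed G C ℓ x + #S = ℓ x + τ ∧
      (x ∈ Q → ∀ y ∈ D, G.Adj x y →
        #{z ∈ D | nbs G C z = nbs G C y ∧ (z ∈ S ↔ y ∈ S)} ≤ hi) := by
    intro x hx
    by_cases hxQ : x ∈ Q
    · obtain ⟨h1, h2⟩ := hwin x hxQ
      obtain ⟨S, hS, hSc, hS'⟩ := exists_balanced hI he hie hx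
        (n := ℓ x + τ - innerRed G C ℓ x) (by omega) (by omega)
      refine ⟨S, fun z hz => ?_, by have := hle x hx; omega, fun _ => hS'⟩
      have hz' := mem_filter.1 (hS hz)
      exact mem_outside.2 ⟨hz'.2, (hD z hz'.1).1, (hD z hz'.1).2.1⟩
    · obtain ⟨S, hS, hSc⟩ := exists_subset_card_eq (s := outside G P C x)
        (n := ℓ x + τ - innerRed G C ℓ x) (by have := hfeas x hx; omega)
      exact ⟨S, hS, by have := hle x hx; omega, fun h => absurd h hxQ⟩
  choose! S hS hSc hSQ using hex
  refine good_union_label h.disj h.isOrbit.invariant h.root h.rigid h.size h.blue h.blue_mem hℓ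
    hS hSc ?_ ?_ hCblue
  · intro y hyP hyC hy
    by_cases hyD : y ∈ D
    · obtain ⟨x, hx, hxy⟩ := hhit y hyD
      refine le_trans ?_ ((hSQ x (hQ hx) hx y hyD hxy).trans (hhi y hyD))
      rw [← Set.ncard_coe_finset]
      refine Set.ncard_le_ncard ?_ (finite_toSet _)
      rintro z ⟨hz, h1, h2⟩
      rw [(hD y hyD).2.2] at hz
      simp only [coe_filter, Set.mem_ofPred_eq]
      exact ⟨hz, h1, h2 x (hQ hx) hxy⟩
    · refine le_trans (Set.ncard_le_ncard ?_ ?_) (hblock y hyP hyC hyD hy)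
      · rintro z ⟨hz, h1, -⟩
        exact ⟨hz, h1⟩
      · obtain ⟨x, hx, hxy⟩ := hy
        refine finite_of_forall_adj (G := G) (x := x) fun z hz => ?_
        have : x ∈ nbs G C z := by rw [hz.2]; simp [hx, hxy]
        exact (mem_nbs.1 this).2
  · intro y hyP hyC hy
    refine (hpblue y hyP hyC hy).imp_left ?_
    rintro ⟨x, hx, hxy, h0⟩
    refine ⟨x, hx, hxy, ?_⟩
    have := hSc x hx
    rw [card_eq_zero.1 (by omega : #(S x) = 0)]
    simp

theorem incidence_empty (C : Finset V) : Incidence G C ∅ 0 0 0 0 := by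
  constructor <;> simp

theorem orbit_finite_of_adj {c : Sym2 V → Bool} {P : Set V} {C : Finset V}
    (hC : Invariant G c P C) {y : V} (hy : ∃ x ∈ C, G.Adj x y) : (orbit G c P y).Finite := by
  refine (C.biUnion fun x => G.neighborFinset x).finite_toSet.subset ?_
  rintro _ ⟨φ, hφ, rfl⟩
  obtain ⟨x, hx, hxy⟩ := hy
  simp only [coe_biUnion, Set.mem_iUnion, mem_coe, mem_neighborFinset]
  exact ⟨φ x, hC φ hφ x hx, φ.map_adj_iff.2 hxy⟩

/-- An orbit `D` incompletely joined to `C` with too many twins relative to `C`. -/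
structure BadOrbit (G : SimpleGraph V) [G.LocallyFinite] (c : Sym2 V → Bool) (P : Set V)
    (Δ : ℕ) (C D : Finset V) (s k e β : ℕ) : Prop where
  inc : Incidence G C D s k e β
  isOrbit : IsOrbit G c P D
  notMem : ∀ y ∈ D, y ∉ P ∧ y ∉ C
  outdeg_eq : ∀ y ∈ D, outdeg G P y = Δ
  k_pos : 1 ≤ k
  k_lt : k < s
  β_pos : 1 ≤ β
  β_lt : β < Δ
  lt_e : Δ - β < e
  key : s * Δ ≤ #C + s * (k * (Δ - β))

theorem exists_badOrbit {c : Sym2 V → Bool} {P : Set V} {Δ : ℕ} {C : Finset V}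
    (hC : IsOrbit G c P C) (hm : #C ≤ Δ) {y : V} (hyP : y ∉ P)
    (hyC : y ∉ C) (hy : ∃ x ∈ C, G.Adj x y) (hnf : #(nbs G C y) < #C)
    (hor : outdeg G P y = Δ ∨
      (#C ≤ (orbit G c P y).ncard ∧ (orbit G c P y).ncard ≤ outdeg G P y))
    (hbad : ¬ {z ∈ orbit G c P y | nbs G C z = nbs G C y}.ncard ≤
      max 1 (outdeg G P y - #(nbs G C y))) :
    ∃ D s k e β, BadOrbit G c P Δ C D s k e β ∧ y ∈ D := by
  have hfin := orbit_finite_of_adj hC.invariant hy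
  obtain ⟨D, hD, hyD⟩ : ∃ D, IsOrbit G c P D ∧ y ∈ D :=
    ⟨_, isOrbit_of_finite hfin, by simpa using mem_orbit_self c P y⟩
  obtain ⟨s, k, e, β, hI⟩ := exists_incidence hC hD
  have he : {z ∈ orbit G c P y | nbs G C z = nbs G C y}.ncard = e := by
    rw [← hI.card_block y hyD, ← Set.ncard_coe_finset, hD.2 y hyD]
    congr 1
    ext z
    simp
  have hβ := hI.card_nbs y hyD
  have hβ1 : 1 ≤ β := by
    rw [← hβ]
    obtain ⟨x, hx, hxy⟩ := hy
    exact card_pos.2 ⟨x, mem_nbs.2 ⟨hx, hxy⟩⟩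
  obtain ⟨hs, hk, he1⟩ := hI.pos hC.1 hD.1 hβ1
  rw [he, hβ, le_max_iff, not_or] at hbad
  rw [hβ] at hnf
  have hks := lt_of_lt hI.mul_eq hs hnf
  have hor' : outdeg G P y = Δ := by
    refine hor.resolve_right fun h => ?_
    rw [hD.ncard_eq hyD, hI.card_eq] at h
    have := add_le_of_nonfull hI.mul_eq hks h.1
    omega
  refine ⟨D, s, k, e, β, ⟨hI, hD, ?_, ?_, hk, hks, hβ1, by omega, by omega, ?_⟩, hyD⟩
  · intro z hz
    have hz' : z ∈ orbit G c P y := by rw [hD.2 y hyD]; exact hz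
    refine ⟨notMem_of_mem_orbit hz' hyP, fun h => ?_⟩
    obtain ⟨φ, hφ, rfl⟩ := hz'
    exact hyC ((hC.invariant.mem_iff hφ).1 h)
  · intro z hz
    have hz' : z ∈ orbit G c P y := by rw [hD.2 y hyD]; exact hz
    rw [RootedColouring.outdeg_eq hz', hor']
  · exact bad_arith hI.mul_eq hk hks (by omega) hm

theorem BadOrbit.add_le {c : Sym2 V → Bool} {P : Set V} {Δ : ℕ} {C D : Finset V} {s k e β : ℕ}
    (h : BadOrbit G c P Δ C D s k e β) : k * (Δ - β) + k ≤ k * e := by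
  have := Nat.mul_le_mul_left k h.lt_e
  rw [Nat.succ_eq_add_one, mul_add, mul_one] at this
  exact this

theorem IsOrbit.disjoint {c : Sym2 V → Bool} {P : Set V} {C D : Finset V} (hC : IsOrbit G c P C)
    (hD : IsOrbit G c P D) {x : V} (hx : x ∈ D) (hxC : x ∉ C) : Disjoint C D := by
  rw [Finset.disjoint_left]
  intro z hz hz'
  refine hxC ?_
  rw [← mem_coe, ← hC.2 z hz, hD.2 z hz']
  exact hx

theorem card_adj_add_le {D D' : Finset V} (h : Disjoint D D') (x : V) :
    #{z ∈ D | G.Adj x z} + #{z ∈ D' | G.Adj x z} ≤ G.degree x := by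
  rw [← card_union_of_disjoint (disjoint_filter_filter h), ← card_neighborFinset_eq_degree]
  refine card_le_card fun z hz => ?_
  simp only [mem_union, mem_filter, mem_neighborFinset] at hz ⊢
  tauto

theorem BadOrbit.mem_of_bad {c : Sym2 V → Bool} {P : Set V} {Δ : ℕ} {C D D' : Finset V}
    {s k e β s' k' e' β' : ℕ} (hreg : G.IsRegularOfDegree Δ) (hC : C.Nonempty) (hm : #C ≤ Δ)
    (h : BadOrbit G c P Δ C D s k e β) (h' : BadOrbit G c P Δ C D' s' k' e' β')
    {y : V} (hy : y ∈ D') : y ∈ D := by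
  by_contra hyD
  obtain ⟨x, hx⟩ := hC
  have h1 := card_adj_add_le (G := G) (h.isOrbit.disjoint h'.isOrbit hy hyD) x
  rw [h.inc.card_adj x hx, h'.inc.card_adj x hx, hreg x] at h1
  have h2 := bad_half h.key (by have := h.k_pos; have := h.k_lt; omega) hm
  have h3 := bad_half h'.key (by have := h'.k_pos; have := h'.k_lt; omega) hm
  have h4 := h.add_le
  have h5 := h'.add_le
  have := h.k_pos
  have := h'.k_pos
  omega

theorem BadOrbit.not_full {c : Sym2 V → Bool} {P : Set V} {Δ : ℕ} {C D D' : Finset V}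
    {s k e β : ℕ} (hreg : G.IsRegularOfDegree Δ) (hC : C.Nonempty)
    (h : BadOrbit G c P Δ C D s k e β) (h' : IsOrbit G c P D') (hcard : #C ≤ #D')
    (hfull : ∀ x ∈ C, ∀ y ∈ D', G.Adj x y) : False := by
  obtain ⟨x, hx⟩ := hC
  obtain ⟨y, hy⟩ := h'.1
  have hyD : y ∉ D := by
    intro hyD
    have h1 := h.inc.card_nbs y hyD
    have h2 : nbs G C y = C := by
      ext z; simp only [mem_nbs, and_iff_left_iff_imp]; exact fun hz => hfull z hz y hy
    rw [h2] at h1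
    have := h.inc.mul_eq
    have := h.k_lt
    have := h.β_pos
    rw [h1, mul_comm] at *
    nlinarith
  have h1 := card_adj_add_le (G := G) (h.isOrbit.disjoint h' hy hyD) x
  rw [h.inc.card_adj x hx, hreg x, filter_true_of_mem fun y hy => hfull x hx y hy] at h1
  have h2 := bad_le h.key (by have := h.k_lt; omega)
  have h4 := h.add_le
  have := h.k_pos
  omega

/-- The vertices of `C` splitting the bad orbit get labels in a central window. -/
theorem BadOrbit.window {c : Sym2 V → Bool} {P : Set V} {Δ : ℕ} {C D : Finset V}
    {s k e β : ℕ} (h : BadOrbit G c P Δ C D s k e β) (hCP : Disjoint P (C : Set V)) {τ : ℕ}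
    (hτ : #C + τ ≤ Δ) {ℓ : V → ℕ} {x : V} (hx : x ∈ C) (hd : outdeg G P x < Δ + τ)
    (hlo : Δ - 1 - k * (Δ - β) ≤ ℓ x) (hup : ℓ x + (Δ - 1 - k * (Δ - β)) < #C) :
    innerRed G C ℓ x + k * (e - (Δ - β)) ≤ ℓ x + τ ∧
      ℓ x + τ ≤ innerRed G C ℓ x + k * (Δ - β) := by
  have h1 : #{z ∈ D | G.Adj x z} ≤ #(outside G P C x) := by
    refine card_le_card fun z hz => ?_
    have hz' := mem_filter.1 hz
    exact mem_outside.2 ⟨hz'.2, h.notMem z hz'.1⟩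
  rw [h.inc.card_adj x hx] at h1
  have h2 := card_outside (G := G) hCP x
  have h3 := innerRed_le_card (G := G) (C := C) (ℓ := ℓ) x
  have h4 := h.add_le
  have h5 := h.k_pos
  rw [Nat.mul_sub]
  constructor <;> omega

theorem BadOrbit.le_degree {c : Sym2 V → Bool} {P : Set V} {Δ : ℕ} {C D : Finset V}
    {s k e β : ℕ} (hreg : G.IsRegularOfDegree Δ) (h : BadOrbit G c P Δ C D s k e β)
    (hC : C.Nonempty) : k * e ≤ Δ := by
  obtain ⟨x, hx⟩ := hC
  rw [← h.inc.card_adj x hx, ← hreg x, ← card_neighborFinset_eq_degree]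
  exact card_le_card fun z hz => by simpa using (mem_filter.1 hz).2

theorem BadOrbit.exists_hitting {c : Sym2 V → Bool} {P : Set V} {Δ : ℕ} {C D : Finset V}
    {s k e β : ℕ} (hreg : G.IsRegularOfDegree Δ) (h : BadOrbit G c P Δ C D s k e β)
    (hC : C.Nonempty) : ∃ Q ⊆ C, Q.Nonempty ∧ #Q + 2 * (Δ - 1 - k * (Δ - β)) = #C ∧
      ∀ y ∈ D, ∃ x ∈ Q, G.Adj x y := by
  have hle := h.le_degree hreg hC
  have h1 := h.add_le
  have hk := h.k_pos
  have hks := h.k_lt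
  have hex : ∀ j ∈ D.image (nbs G C), ∃ x, x ∈ j := by
    intro j hj
    obtain ⟨z, hz, rfl⟩ := mem_image.1 hj
    exact card_pos.1 (by rw [h.inc.card_nbs z hz]; exact h.β_pos)
  have : Nonempty V := ⟨hC.choose⟩
  choose! f hf using hex
  have hQ₀ : (D.image (nbs G C)).image f ⊆ C := by
    intro x hx
    obtain ⟨j, hj, rfl⟩ := mem_image.1 hx
    have h2 := hf j hj
    obtain ⟨z, hz, rfl⟩ := mem_image.1 hj
    exact (mem_nbs.1 h2).1
  have hcard : #((D.image (nbs G C)).image f) ≤ s := card_image_le.trans h.inc.card_image.le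
  obtain ⟨a, ha⟩ : ∃ a, Δ = k * (Δ - β) + a + 1 := ⟨Δ - 1 - k * (Δ - β), by omega⟩
  have ha' : Δ - 1 - k * (Δ - β) = a := by omega
  have hs : s + 2 * a ≤ #C := by
    have hkey := h.key
    set w := k * (Δ - β)
    rw [ha] at hkey
    have : 2 * a ≤ s * a := Nat.mul_le_mul_right _ (by omega)
    have h3 : s * (w + a + 1) = s * w + s * a + s := by ring
    omega
  obtain ⟨Q, hQ₀Q, hQC, hQ⟩ := exists_subsuperset_card_eq hQ₀ (n := #C - 2 * a) (by omega)
    (by omega)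
  have hhit : ∀ y ∈ D, ∃ x ∈ Q, G.Adj x y := by
    intro y hy
    have hj := mem_image_of_mem (nbs G C) hy
    exact ⟨f (nbs G C y), hQ₀Q (mem_image_of_mem _ hj), (mem_nbs.1 (hf _ hj)).2⟩
  refine ⟨Q, hQC, ?_, by omega, hhit⟩
  obtain ⟨y, hy⟩ := h.isOrbit.1
  obtain ⟨x, hx, -⟩ := hhit y hy
  exact ⟨x, hx⟩

theorem Label.card_lt {C : Finset V} {ℓ : V → ℕ} (h : Label C ℓ) {i : ℕ} (hi : i ≤ #C) :
    #{x ∈ C | ℓ x < i} = i := by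
  rw [h.card_filter (fun j => j < i)]
  have : ({j ∈ range #C | j < i} : Finset ℕ) = range i := by
    ext j; simp only [mem_filter, mem_range]; omega
  rw [this, card_range]

/-- The labelled colouring in the presence of a bad orbit. -/
theorem Pre.exists_good_of_bad {Δ : ℕ} {r : V} {P₀ P : Set V}
    {c : Sym2 V → Bool} {C D Q : Finset V} (h : Pre G r P₀ P c C) {s k e β τ : ℕ}
    (hb : BadOrbit G c P Δ C D s k e β) (hτ : #C + τ ≤ Δ) (hQ : Q ⊆ C) (hQne : Q.Nonempty)
    (hhit : ∀ y ∈ D, ∃ x ∈ Q, G.Adj x y) {ℓ : V → ℕ} (hℓ : Label C ℓ)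
    (hwin : ∀ x ∈ Q, Δ - 1 - k * (Δ - β) ≤ ℓ x ∧ ℓ x + (Δ - 1 - k * (Δ - β)) < #C)
    (hd : ∀ x ∈ C, outdeg G P x < Δ + τ)
    (hfeas : ∀ x ∈ C, ℓ x + τ ≤ innerRed G C ℓ x + #(outside G P C x))
    (hblock : ∀ y ∉ P, y ∉ C → y ∉ D → (∃ x ∈ C, G.Adj x y) →
      {z ∈ orbit G c P y | nbs G C z = nbs G C y}.ncard ≤ max 1 (outdeg G P y - #(nbs G C y)))
    (hpblue : ∀ y ∉ P, y ∉ C → (∃ x ∈ C, G.Adj x y) →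
      (∃ x ∈ C, G.Adj x y ∧ ℓ x + τ = 0) ∨ #(nbs G C y) < outdeg G P y)
    (hCblue : ∀ x ∈ C, x ∉ P₀ → ℓ x + τ < outdeg G P x) :
    ∃ c' : Sym2 V → Bool, Agree c c' P ∧ Good G r P₀ (P ∪ C) c' ∧
      ∀ x ∈ C, #{y ∈ G.neighborFinset x | y ∉ P ∧ c' s(x, y) = true} = ℓ x + τ := by
  have hwin' := fun x hx =>
    hb.window h.disj hτ (hQ hx) (hd x (hQ hx)) (hwin x hx).1 (hwin x hx).2
  refine h.exists_good_label hℓ hfeas hb.inc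
    (fun y hy => ⟨(hb.notMem y hy).1, (hb.notMem y hy).2, hb.isOrbit.2 y hy⟩)
    (hi := Δ - β) ?_ hb.lt_e.le hQ hhit hwin' ?_ hblock hpblue hCblue
  · obtain ⟨x, hx⟩ := hQne
    have h1 := hwin' x hx
    have h2 : k * (e - (Δ - β)) ≤ k * (Δ - β) := by omega
    have := Nat.le_of_mul_le_mul_left h2 hb.k_pos
    omega
  · intro y hy
    rw [hb.outdeg_eq y hy, hb.inc.card_nbs y hy]
    exact le_max_right _ _

theorem Pre.exists_good_of_nonfull {Δ : ℕ} (hreg : G.IsRegularOfDegree Δ) {r : V} {P₀ P : Set V}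
    {c : Sym2 V → Bool} {C : Finset V} (h : Pre G r P₀ P c C) {τ : ℕ} (hτ : #C + τ ≤ Δ)
    (hd : ∀ x ∈ C, #C + τ ≤ outdeg G P x ∧ outdeg G P x < Δ + τ)
    (hnf : ∀ y ∉ P, y ∉ C → (∃ x ∈ C, G.Adj x y) → #(nbs G C y) < #C ∧
      (outdeg G P y = Δ ∨
        (#C ≤ (orbit G c P y).ncard ∧ (orbit G c P y).ncard ≤ outdeg G P y))) :
    ∃ c' : Sym2 V → Bool, Agree c c' P ∧ Good G r P₀ (P ∪ C) c' := by
  have hfeas : ∀ ℓ, Label C ℓ →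
      ∀ x ∈ C, ℓ x + τ ≤ innerRed G C ℓ x + #(outside G P C x) := by
    intro ℓ hℓ x hx
    have h1 := le_innerRed (G := G) hℓ hx
    have h2 := card_outside (G := G) h.disj x
    have h3 := hd x hx
    omega
  have hpblue : ∀ y ∉ P, y ∉ C → (∃ x ∈ C, G.Adj x y) → #(nbs G C y) < outdeg G P y := by
    intro y hyP hyC hy
    have := hnf y hyP hyC hy
    omega
  have hCblue : ∀ ℓ, Label C ℓ → ∀ x ∈ C, x ∉ P₀ → ℓ x + τ < outdeg G P x := by
    intro ℓ hℓ x hx _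
    have h1 := hℓ.lt x hx
    have h3 := hd x hx
    omega
  by_cases hbad : ∃ D s k e β, BadOrbit G c P Δ C D s k e β
  · obtain ⟨D, s, k, e, β, hb⟩ := hbad
    obtain ⟨Q, hQC, hQne, hQ, hhit⟩ := hb.exists_hitting hreg h.isOrbit.1
    obtain ⟨q, hq⟩ := exists_index Q
    obtain ⟨ℓ, hℓ, hℓq⟩ := exists_label (C := C) hQC
      (f := fun x => (Δ - 1 - k * (Δ - β)) + q x)
      (fun x hx y hy hxy => hq.inj hx hy (by simpa using hxy))
      (fun x hx => by have := hq.lt x hx; omega)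
    have hblock : ∀ y ∉ P, y ∉ C → y ∉ D → (∃ x ∈ C, G.Adj x y) →
        {z ∈ orbit G c P y | nbs G C z = nbs G C y}.ncard ≤
          max 1 (outdeg G P y - #(nbs G C y)) := by
      intro y hyP hyC hyD hy
      by_contra hcon
      obtain ⟨D', s', k', e', β', hb', hy'⟩ := exists_badOrbit h.isOrbit (by omega) hyP hyC hy
        (hnf y hyP hyC hy).1 (hnf y hyP hyC hy).2 hcon
      exact hyD (hb.mem_of_bad hreg h.isOrbit.1 (by omega) hb' hy')
    obtain ⟨c', h1, h2, -⟩ := h.exists_good_of_bad hb hτ hQC hQne hhit hℓ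
      (fun x hx => by have := hq.lt x hx; rw [hℓq x hx]; omega) (fun x hx => (hd x hx).2)
      (hfeas ℓ hℓ) hblock (fun y h1 h2 h3 => Or.inr (hpblue y h1 h2 h3)) (hCblue ℓ hℓ)
    exact ⟨c', h1, h2⟩
  · obtain ⟨ℓ, hℓ⟩ := exists_index C
    have hblock : ∀ y ∉ P, y ∉ C → y ∉ (∅ : Finset V) → (∃ x ∈ C, G.Adj x y) →
        {z ∈ orbit G c P y | nbs G C z = nbs G C y}.ncard ≤
          max 1 (outdeg G P y - #(nbs G C y)) := by
      intro y hyP hyC _ hy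
      by_contra hcon
      obtain ⟨D', s', k', e', β', hb', hy'⟩ := exists_badOrbit h.isOrbit (by omega) hyP hyC hy
        (hnf y hyP hyC hy).1 (hnf y hyP hyC hy).2 hcon
      exact hbad ⟨_, _, _, _, _, hb'⟩
    obtain ⟨c', h1, h2, -⟩ := h.exists_good_label (D := ∅) (Q := ∅) (hi := 0) hℓ (hfeas ℓ hℓ)
      (incidence_empty C) (by simp) (by simp) (by simp) (by simp) (by simp) (by simp) (by simp)
      hblock
      (fun y h1 h2 h3 => Or.inr (hpblue y h1 h2 h3)) (hCblue ℓ hℓ)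
    exact ⟨c', h1, h2⟩

theorem nbs_eq_self {C : Finset V} {y : V} : nbs G C y = C ↔ ∀ x ∈ C, G.Adj x y := by
  rw [nbs, filter_eq_self]

theorem nbs_eq_self_of_mem_orbit {c : Sym2 V → Bool} {P : Set V} {C : Finset V}
    (hC : Invariant G c P C) {y z : V} (hz : z ∈ orbit G c P y) (hy : nbs G C y = C) :
    nbs G C z = C := by
  obtain ⟨φ, hφ, rfl⟩ := hz
  rw [nbs_map hC hφ, hy]
  refine eq_of_subset_of_card_le ?_ (card_image_of_injective _ φ.injective).ge
  intro x hx
  obtain ⟨u, hu, rfl⟩ := mem_image.1 hx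
  exact hC φ hφ u hu

/-- Two elements in the same class with respect to all thresholds are equal, if small. -/
theorem eq_of_threshold {m n a b ε : ℕ} (hε : ε = if m < n then 1 else 0) (hmn : m ≤ n)
    (ha : a < m) (hb : b < n) (h : ∀ i < m, (b < i + ε ↔ a < i + ε)) : b = a := by
  split_ifs at hε with hlt <;> subst hε
  · have h1 := h a ha
    by_cases hba : b < m
    · have := h b hba
      omega
    · omega
  · rcases lt_trichotomy a b with hab | hab | hab
    · have := h (a + 1) (by omega); omega
    · exact hab.symm
    · have := h (b + 1) (by omega); omega

/-- The colouring used when some orbit is completely joined to `C`. -/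
theorem Pre.exists_good_of_full {Δ : ℕ} (hreg : G.IsRegularOfDegree Δ) {r : V} {P₀ P : Set V}
    {c : Sym2 V → Bool} {C : Finset V} (h : Pre G r P₀ P c C) (hm : #C ≤ Δ)
    (hmin : ∀ y ∉ P, y ∉ C → (∃ x ∈ C, G.Adj x y) → #C ≤ (orbit G c P y).ncard)
    (hor : ∀ y ∉ P, y ∉ C → (∃ x ∈ C, G.Adj x y) →
      (outdeg G P y = Δ ∨ (orbit G c P y).ncard ≤ outdeg G P y))
    {y₀ : V} (hy₀P : y₀ ∉ P) (hy₀C : y₀ ∉ C) (hfull : nbs G C y₀ = C) :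
    ∃ c' : Sym2 V → Bool, Agree c c' P ∧ Good G r P₀ (P ∪ C) c' := by
  have hinv := h.isOrbit.invariant
  obtain ⟨x₀, hx₀⟩ := h.isOrbit.1
  obtain ⟨ℓ, hℓ⟩ := exists_index C
  have hlab : ∀ S : Set V, ∃ f : V → ℕ, ∀ hS : S.Finite, Label hS.toFinset f := by
    intro S
    by_cases hS : S.Finite
    · obtain ⟨f, hf⟩ := exists_index hS.toFinset
      exact ⟨f, fun _ => hf⟩
    · exact ⟨fun _ => 0, fun h => absurd h hS⟩
  choose lab hlab using hlab
  obtain ⟨ε, hε⟩ : ∃ ε : Set V → ℕ, ∀ S, ε S = if #C < S.ncard then 1 else 0 := ⟨_, fun _ => rfl⟩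
  obtain ⟨ρ, hρ⟩ : ∃ ρ : V → V → Prop, ∀ x y, ρ x y ↔ y ∉ C ∧ nbs G C y = C ∧
    lab (orbit G c P y) y < ℓ x + ε (orbit G c P y) := ⟨_, fun _ _ => Iff.rfl⟩
  have hadj : ∀ {y}, nbs G C y = C → ∃ x ∈ C, G.Adj x y := fun {y} hy =>
    ⟨x₀, hx₀, nbs_eq_self.1 hy x₀ hx₀⟩
  have hnotC : ∀ {y z}, z ∈ orbit G c P y → y ∉ C → z ∉ C := by
    rintro y _ ⟨φ, hφ, rfl⟩ hy hz
    exact hy ((hinv.mem_iff hφ).1 hz)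
  have hfin : ∀ {y}, (∃ x ∈ C, G.Adj x y) → (orbit G c P y).Finite :=
    fun hy => orbit_finite_of_adj hinv hy
  have hle : ∀ y ∉ P, y ∉ C → nbs G C y = C → (orbit G c P y).ncard ≤ outdeg G P y := by
    intro y hyP hyC hy
    refine (hor y hyP hyC (hadj hy)).elim (fun h1 => ?_) id
    rw [h1, ← hreg x₀, ← card_neighborFinset_eq_degree, ← Set.ncard_coe_finset]
    refine Set.ncard_le_ncard (fun z hz => ?_) (finite_toSet _)
    have := nbs_eq_self.1 (nbs_eq_self_of_mem_orbit hinv hz hy) x₀ hx₀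
    simpa using this
  have hρ₀ : ∀ y ∉ C, nbs G C y = C → ∀ x, ∀ z ∈ orbit G c P y,
      (ρ x z ↔ lab (orbit G c P y) z < ℓ x + ε (orbit G c P y)) := by
    intro y hyC hy x z hz
    rw [hρ, orbit_eq hz]
    exact ⟨fun h => h.2.2, fun h => ⟨hnotC hz hyC, nbs_eq_self_of_mem_orbit hinv hz hy, h⟩⟩
  have hlt : ∀ y, nbs G C y = C → ∀ z ∈ orbit G c P y,
      lab (orbit G c P y) z < (orbit G c P y).ncard := by
    intro y hy z hz
    have h1 := (hlab (orbit G c P y) (hfin (hadj hy))).lt z (by simpa using hz)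
    rwa [← Set.ncard_eq_toFinset_card _ (hfin (hadj hy))] at h1
  have hcount : ∀ x ∈ C, #{y ∈ G.neighborFinset x | y ∈ orbit G c P y₀ ∧ ρ x y} =
      ℓ x + ε (orbit G c P y₀) := by
    intro x hx
    have hf := hfin (hadj hfull)
    have h1 := (hlab (orbit G c P y₀) hf).card_lt (i := ℓ x + ε (orbit G c P y₀)) (by
      rw [← Set.ncard_eq_toFinset_card _ hf]
      have h1 := hℓ.lt x hx
      have h2 := hmin y₀ hy₀P hy₀C (hadj hfull)
      rw [hε]
      split_ifs <;> omega)
    rw [← h1]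
    congr 1
    ext z
    simp only [mem_filter, mem_neighborFinset, Set.Finite.mem_toFinset]
    constructor
    · rintro ⟨-, hz, hz'⟩
      exact ⟨hz, (hρ₀ y₀ hy₀C hfull x z hz).1 hz'⟩
    · rintro ⟨hz, hz'⟩
      exact ⟨nbs_eq_self.1 (nbs_eq_self_of_mem_orbit hinv hz hfull) x hx, hz,
        (hρ₀ y₀ hy₀C hfull x z hz).2 hz'⟩
  refine Exists.imp (fun c' h => ⟨h.1, h.2.1⟩) (good_union (ρ := ρ) (W := orbit G c P y₀)
    (P₀ := P₀) h.disj hinv h.root h.rigid h.size h.blue h.blue_mem ?_ (invariant_orbit c P y₀)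
    ?_ ?_ ?_ ?_ ?_)
  · intro x hx y hy _ hxy
    exact absurd hy ((hρ x y).1 hxy).1
  · rw [Set.disjoint_left]
    exact fun z hz hz' => notMem_of_mem_orbit hz' hy₀P hz
  · intro x hx y hy hxy
    simp only [hcount x hx, hcount y hy] at hxy
    exact hℓ.inj hx hy (by omega)
  · intro y hyP hyC hy
    have hf := hfin hy
    by_cases hyf : nbs G C y = C
    · have hn := hmin y hyP hyC hy
      change _ ≤ max 1 (outdeg G P y - #(nbs G C y))
      rw [hyf]
      have key : ∀ z ∈ orbit G c P y, (∀ x ∈ C, (G.Adj x z ↔ G.Adj x y) ∧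
          (G.Adj x y → (ρ x z ↔ ρ x y))) → ∀ i < #C,
          (lab (orbit G c P y) z < i + ε (orbit G c P y) ↔
            lab (orbit G c P y) y < i + ε (orbit G c P y)) := by
        intro z hz h1 i hi
        obtain ⟨x, hx, rfl⟩ := hℓ.exists_eq hi
        rw [← hρ₀ y hyC hyf x z hz, ← hρ₀ y hyC hyf x y (mem_orbit_self c P y)]
        exact (h1 x hx).2 (nbs_eq_self.1 hyf x hx)
      by_cases hym : lab (orbit G c P y) y < #C
      · refine le_trans ?_ (le_max_left _ _)
        rw [← Set.ncard_singleton y]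
        refine Set.ncard_le_ncard ?_ (Set.finite_singleton y)
        rintro z ⟨hz, h1⟩
        refine (hlab (orbit G c P y) hf).inj (by simpa using hz)
          (by simpa using mem_orbit_self c P y) ?_
        exact eq_of_threshold (hε _) hn hym (hlt y hyf z hz) (key z hz h1)
      · refine le_trans ?_ (le_max_right _ _)
        have hyn := hlt y hyf y (mem_orbit_self c P y)
        have hε1 : ε (orbit G c P y) = 1 := by rw [hε, if_pos (by omega)]
        have hCpos := h.isOrbit.1.card_pos
        have hsub : {z ∈ orbit G c P y | ∀ x ∈ C, (G.Adj x z ↔ G.Adj x y) ∧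
            (G.Adj x y → (ρ x z ↔ ρ x y))} ⊆
            (({z ∈ hf.toFinset | ¬ lab (orbit G c P y) z < #C} : Finset V) : Set V) := by
          rintro z ⟨hz, h1⟩
          have := key z hz h1 (#C - 1) (by omega)
          rw [hε1] at this
          simp only [coe_filter, Set.Finite.mem_toFinset, Set.mem_ofPred_eq]
          refine ⟨hz, ?_⟩
          omega
        refine (Set.ncard_le_ncard hsub (finite_toSet _)).trans ?_
        rw [Set.ncard_coe_finset]
        have h2 := card_filter_add_card_filter_not (s := hf.toFinset)
          (fun z => lab (orbit G c P y) z < #C)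
        rw [← Set.ncard_eq_toFinset_card _ hf, (hlab (orbit G c P y) hf).card_lt (by
          rw [← Set.ncard_eq_toFinset_card _ hf]; exact hn)] at h2
        have h3 := hle y hyP hyC hyf
        omega
    · by_contra hcon
      have hnf : #(nbs G C y) < #C :=
        card_lt_card ((filter_subset _ _).ssubset_of_ne hyf)
      have hbl : ¬ {z ∈ orbit G c P y | nbs G C z = nbs G C y}.ncard ≤
          max 1 (outdeg G P y - #(nbs G C y)) := by
        intro hle
        refine hcon (le_trans (Set.ncard_le_ncard ?_ (hf.subset fun z hz => hz.1)) hle)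
        rintro z ⟨hz, h1⟩
        refine ⟨hz, ?_⟩
        ext x
        simp only [mem_nbs]
        exact and_congr_right fun hx => (h1 x hx).1
      obtain ⟨D, s, k, e, β, hb, -⟩ := exists_badOrbit h.isOrbit hm hyP hyC hy hnf
        ((hor y hyP hyC hy).imp_right fun h1 => ⟨hmin y hyP hyC hy, h1⟩) hbl
      have hf₀ := hfin (hadj hfull)
      refine hb.not_full hreg h.isOrbit.1 (isOrbit_of_finite hf₀) ?_ ?_
      · rw [← Set.ncard_eq_toFinset_card _ hf₀]
        exact hmin y₀ hy₀P hy₀C (hadj hfull)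
      · intro x hx z hz
        exact nbs_eq_self.1 (nbs_eq_self_of_mem_orbit hinv (by simpa using hz) hfull) x hx
  · intro y hyP hyC hy
    by_cases hyf : nbs G C y = C
    · by_cases hn : #C < (orbit G c P y).ncard
      · right
        change #(nbs G C y) < _
        rw [hyf]
        exact hn.trans_le (hle y hyP hyC hyf)
      · left
        obtain ⟨x, hx, hx0⟩ := hℓ.exists_eq h.isOrbit.1.card_pos
        refine ⟨x, hx, nbs_eq_self.1 hyf x hx, ?_⟩
        rw [hρ, hε, if_neg hn, hx0]
        omega
    · left
      obtain ⟨x, hx, hxy⟩ := hy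
      exact ⟨x, hx, hxy, fun h1 => hyf ((hρ x y).1 h1).2.1⟩
  · intro x hx _
    right
    have hf₀ := hfin (hadj hfull)
    have hn := hmin y₀ hy₀P hy₀C (hadj hfull)
    have hCpos := h.isOrbit.1.card_pos
    obtain ⟨z, hz, hz'⟩ := (hlab (orbit G c P y₀) hf₀).exists_eq
      (i := (orbit G c P y₀).ncard - 1) (by rw [← Set.ncard_eq_toFinset_card _ hf₀]; omega)
    rw [Set.Finite.mem_toFinset] at hz
    refine ⟨z, notMem_of_mem_orbit hz hy₀P,
      nbs_eq_self.1 (nbs_eq_self_of_mem_orbit hinv hz hfull) x hx, ?_⟩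
    rw [hρ₀ y₀ hy₀C hfull x z hz, hz', hε]
    have := hℓ.lt x hx
    split_ifs <;> omega

theorem exists_adj_notMem {r : V} {P : Set V} (hconn : G.Connected) (hr : r ∈ P)
    (hP : P ≠ Set.univ) : ∃ p ∈ P, ∃ y ∉ P, G.Adj p y := by
  obtain ⟨v, hv⟩ := (Set.ne_univ_iff_exists_notMem P).1 hP
  obtain ⟨w⟩ := hconn.preconnected r v
  obtain ⟨d, -, hd, hd'⟩ := w.exists_boundary_dart P hr hv
  exact ⟨d.fst, hd, d.snd, hd', d.adj⟩

theorem outdeg_lt {Δ : ℕ} (hreg : G.IsRegularOfDegree Δ) {P : Set V} {p y : V} (hp : p ∈ P)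
    (hpy : G.Adj p y) : outdeg G P y < Δ := by
  rw [← hreg y, ← card_neighborFinset_eq_degree]
  refine card_lt_card ⟨filter_subset _ _, fun h => ?_⟩
  have := h ((G.mem_neighborFinset y p).2 hpy.symm)
  exact (mem_filter.1 this).2 hp

theorem outdeg_eq_degree {Δ : ℕ} (hreg : G.IsRegularOfDegree Δ) {P : Set V} {y : V}
    (h : ¬ ∃ p ∈ P, G.Adj p y) : outdeg G P y = Δ := by
  rw [← hreg y, ← card_neighborFinset_eq_degree, outdeg, filter_true_of_mem]
  exact fun u hu hP => h ⟨u, hP, by simpa [G.adj_comm] using hu⟩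

theorem outdeg_pos {P : Set V} {x y : V} (hx : x ∉ P) (hxy : G.Adj x y) : 1 ≤ outdeg G P y :=
  card_pos.2 ⟨x, by simpa [hx] using hxy.symm⟩

theorem Good.step {Δ : ℕ} (hΔ : 2 ≤ Δ) (hconn : G.Connected) (hreg : G.IsRegularOfDegree Δ)
    {r : V} {P₀ P : Set V} {c : Sym2 V → Bool} (h : Good G r P₀ P c) (hP : P ≠ Set.univ) :
    ∃ P' c', P ⊂ P' ∧ Agree c c' P ∧ Good G r P₀ P' c' := by
  obtain ⟨p, hp, y, hy, hpy⟩ := exists_adj_notMem hconn h.root hP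
  have hex : ∃ n, ∃ y ∉ P, (orbit G c P y).Finite ∧ (orbit G c P y).ncard = n :=
    ⟨_, y, hy, orbit_finite hp hpy, rfl⟩
  obtain ⟨x₀, hx₀, hfin, hcard⟩ := Nat.find_spec hex
  have hmin : ∀ y ∉ P, (orbit G c P y).Finite → (orbit G c P x₀).ncard ≤ (orbit G c P y).ncard := by
    intro y hy hf
    rw [hcard]
    exact Nat.find_min' hex ⟨y, hy, hf, rfl⟩
  obtain ⟨C, hC, hx₀C⟩ : ∃ C, IsOrbit G c P C ∧ x₀ ∈ C :=
    ⟨_, isOrbit_of_finite hfin, by simpa using mem_orbit_self c P x₀⟩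
  rw [hC.ncard_eq hx₀C] at hmin
  have hmΔ : #C < Δ := by
    refine (hmin y hy (orbit_finite hp hpy)).trans_lt ((h.size y hy ⟨p, hp, hpy⟩).trans_lt ?_)
    exact max_lt (by omega) (outdeg_lt hreg hp hpy)
  have hCP : Disjoint P (C : Set V) := by
    rw [Set.disjoint_left, ← hC.2 x₀ hx₀C]
    exact fun z hz hz' => notMem_of_mem_orbit hz' hx₀ hz
  have hpre : Pre G r P₀ P c C := ⟨hCP, hC, h.root, h.rigid, fun y hy _ _ => h.size y hy,
    fun y hy _ _ => h.blue y hy, h.blue_mem⟩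
  have hCpos := hC.1.card_pos
  suffices hs : ∃ c' : Sym2 V → Bool, Agree c c' P ∧ Good G r P₀ (P ∪ C) c' by
    obtain ⟨c', h1, h2⟩ := hs
    exact ⟨P ∪ C, c', ⟨Set.subset_union_left, fun hsub => hx₀ (hsub (Or.inr hx₀C))⟩, h1, h2⟩
  have hout : ∀ x ∈ C, outdeg G P x = outdeg G P x₀ := fun x hx =>
    outdeg_eq (c := c) (by rw [hC.2 x₀ hx₀C]; exact hx)
  have hCnot : ∀ x ∈ C, x ∉ P := fun x hx hxP => Set.disjoint_left.1 hCP hxP hx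
  have hor : ∀ y ∉ P, y ∉ C → (∃ x ∈ C, G.Adj x y) →
      (outdeg G P y = Δ ∨ (orbit G c P y).ncard ≤ outdeg G P y) := by
    rintro y hyP hyC ⟨x, hx, hxy⟩
    by_cases hyadj : ∃ p ∈ P, G.Adj p y
    · right
      have h1 := h.size y hyP hyadj
      rwa [max_eq_right (outdeg_pos (hCnot x hx) hxy)] at h1
    · exact Or.inl (outdeg_eq_degree hreg hyadj)
  have hmin' : ∀ y ∉ P, y ∉ C → (∃ x ∈ C, G.Adj x y) → #C ≤ (orbit G c P y).ncard :=
    fun y hyP _ hy => hmin y hyP (orbit_finite_of_adj hC.invariant hy)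
  by_cases hfull : ∃ y ∉ P, y ∉ C ∧ nbs G C y = C
  · obtain ⟨y₀, hy₀P, hy₀C, hy₀⟩ := hfull
    exact hpre.exists_good_of_full hreg hmΔ.le hmin' hor hy₀P hy₀C hy₀
  have hnf : ∀ y ∉ P, y ∉ C → #(nbs G C y) < #C := fun y hyP hyC =>
    card_lt_card ((filter_subset _ _).ssubset_of_ne fun hy => hfull ⟨y, hyP, hyC, hy⟩)
  by_cases h1 : #C = 1
  · have hno : ∀ y ∉ P, y ∉ C → ¬ ∃ x ∈ C, G.Adj x y := by
      rintro y hyP hyC ⟨x, hx, hxy⟩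
      have h2 := hnf y hyP hyC
      have h3 : 0 < #(nbs G C y) := card_pos.2 ⟨x, mem_nbs.2 ⟨hx, hxy⟩⟩
      omega
    obtain ⟨x₁, hx₁⟩ := card_eq_one.1 h1
    have heq : ∀ x ∈ C, ∀ y ∈ C, x = y := by
      rw [hx₁]; simp
    have hC0 : ∀ x ∈ C, ¬ 1 ≤ outdeg G P x := by
      intro x hx hpos
      obtain ⟨u, hu⟩ := card_pos.1 hpos
      simp only [mem_filter, mem_neighborFinset] at hu
      exact hno u hu.2 (fun huC => G.ne_of_adj hu.1 (heq x hx u huC)) ⟨x, hx, hu.1⟩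
    refine Exists.imp (fun c' h => ⟨h.1, h.2.1⟩) (good_union (ρ := fun _ _ => False)
      (W := Pᶜ) (P₀ := P₀) hCP hC.invariant hpre.root hpre.rigid hpre.size hpre.blue
      hpre.blue_mem (fun _ _ _ _ _ => id) (invariant_compl c P) disjoint_compl_right
      (fun x hx y hy _ => heq x hx y hy) ?_ ?_ ?_)
    · exact fun y hyP hyC hy => absurd hy (hno y hyP hyC)
    · exact fun y hyP hyC hy => absurd hy (hno y hyP hyC)
    · exact fun x hx _ => Or.inl ((h.blue x (hCnot x hx)).resolve_right (hC0 x hx))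
  · have hnf' : ∀ y ∉ P, y ∉ C → (∃ x ∈ C, G.Adj x y) → #(nbs G C y) < #C ∧
      (outdeg G P y = Δ ∨
        (#C ≤ (orbit G c P y).ncard ∧ (orbit G c P y).ncard ≤ outdeg G P y)) :=
      fun y hyP hyC hy => ⟨hnf y hyP hyC, (hor y hyP hyC hy).imp_right fun h2 =>
        ⟨hmin' y hyP hyC hy, h2⟩⟩
    by_cases hadj : ∃ p ∈ P, G.Adj p x₀
    · refine hpre.exists_good_of_nonfull hreg (τ := 0) hmΔ.le (fun x hx => ?_) hnf'
      have h2 := h.size x₀ hx₀ hadj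
      rw [hC.ncard_eq hx₀C] at h2
      obtain ⟨q, hq, hqx⟩ := hadj
      have h3 := outdeg_lt hreg hq hqx
      rw [hout x hx]
      omega
    · refine hpre.exists_good_of_nonfull hreg (τ := 1) hmΔ (fun x hx => ?_) hnf'
      rw [hout x hx, outdeg_eq_degree hreg hadj]
      omega

theorem Good.exists_total {Δ : ℕ} (hΔ : 2 ≤ Δ) (hconn : G.Connected)
    (hreg : G.IsRegularOfDegree Δ) {r : V} {P₀ P : Set V} {c : Sym2 V → Bool}
    (h : Good G r P₀ P c) : ∃ c', Agree c c' P ∧ Good G r P₀ Set.univ c' :=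
  exists_good_univ h fun _ _ hg hne => hg.step hΔ hconn hreg hne

/-- A family of sets of distinct sizes whose atoms are small. -/
theorem exists_family {Δ h : ℕ} (hΔ : 4 ≤ Δ) (hh : 2 ≤ h) (hlt : h < Δ)
    (hne : ¬ (Δ = 4 ∧ h = 2)) :
    ∃ F : ℕ → Finset ℕ, (∀ i < h, F i ⊆ range Δ ∧ #(F i) < Δ) ∧
      (∀ i < h, ∀ j < h, #(F i) = #(F j) → i = j) ∧
      (∀ a < Δ, #{b ∈ range Δ | ∀ i < h, (b ∈ F i ↔ a ∈ F i)} ≤ max 1 (Δ - 1 - h)) ∧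
      (h = Δ - 1 → ∀ a < Δ, ∃ i < h, a ∉ F i) := by
  rcases hh.eq_or_lt with rfl | hh3
  · refine ⟨fun i => range (i + 2), ?_, ?_, ?_, ?_⟩
    · intro i hi
      simp only [range_subset_range, card_range]
      omega
    · intro i hi j hj h
      simpa using h
    · intro a ha
      refine le_trans ?_ (le_max_right _ _)
      beta_reduce
      have h0 : ∀ b, (∀ i < 2, (b ∈ range (i + 2) ↔ a ∈ range (i + 2))) →
          (b < 2 ↔ a < 2) ∧ (b < 3 ↔ a < 3) := by
        intro b hb
        exact ⟨by simpa using hb 0 (by omega), by simpa using hb 1 (by omega)⟩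
      rcases lt_or_ge a 2 with ha2 | ha2
      · have : ({b ∈ range Δ | ∀ i < 2, (b ∈ range (i + 2) ↔ a ∈ range (i + 2))} : Finset ℕ) ⊆
            range 2 := by
          intro b hb
          have := h0 b (mem_filter.1 hb).2
          exact mem_range.2 (by omega)
        have := card_le_card this
        rw [card_range] at this
        omega
      · rcases ha2.eq_or_lt with rfl | ha2
        · have : ({b ∈ range Δ | ∀ i < 2, (b ∈ range (i + 2) ↔ 2 ∈ range (i + 2))} : Finset ℕ) ⊆
              {2} := by
            intro b hb
            have := h0 b (mem_filter.1 hb).2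
            exact mem_singleton.2 (by omega)
          have := card_le_card this
          rw [card_singleton] at this
          omega
        · have : ({b ∈ range Δ | ∀ i < 2, (b ∈ range (i + 2) ↔ a ∈ range (i + 2))} : Finset ℕ) ⊆
              Ico 3 Δ := by
            intro b hb
            have := h0 b (mem_filter.1 hb).2
            have := mem_range.1 (mem_filter.1 hb).1
            exact mem_Ico.2 (by omega)
          have := card_le_card this
          rw [Nat.card_Ico] at this
          omega
    · omega
  · have hmem : ∀ i b, b ∈ (if i = 1 then {1, Δ - 1} else range (i + 1) : Finset ℕ) ↔
        (i = 1 ∧ (b = 1 ∨ b = Δ - 1)) ∨ (i ≠ 1 ∧ b ≤ i) := by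
      intro i b
      split_ifs with hi
      · simp [hi]
      · simp [hi]
    have hcard : ∀ i, #(if i = 1 then {1, Δ - 1} else range (i + 1) : Finset ℕ) = i + 1 := by
      intro i
      split_ifs with hi
      · rw [card_pair (by omega), hi]
      · simp
    refine ⟨fun i => if i = 1 then {1, Δ - 1} else range (i + 1), ?_, ?_, ?_, ?_⟩
    · intro i hi
      rw [hcard]
      refine ⟨fun b hb => ?_, by omega⟩
      rw [hmem] at hb
      exact mem_range.2 (by omega)
    · intro i hi j hj h
      rw [hcard, hcard] at h
      omega
    · intro a ha
      simp only [hmem]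
      have key : ∀ b < Δ, (∀ i < h, ((i = 1 ∧ (b = 1 ∨ b = Δ - 1)) ∨ (i ≠ 1 ∧ b ≤ i) ↔
          (i = 1 ∧ (a = 1 ∨ a = Δ - 1)) ∨ (i ≠ 1 ∧ a ≤ i))) →
          b = a ∨ (h ≤ a ∧ a < Δ - 1 ∧ h ≤ b ∧ b < Δ - 1) := by
        intro b hb H
        have H0 := H 0 (by omega)
        have H1 := H 1 (by omega)
        have H2 := H 2 (by omega)
        have Ha := H a
        have Hb := H b
        omega
      by_cases ha' : h ≤ a ∧ a < Δ - 1
      · refine le_trans ?_ (le_max_right _ _)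
        have : #(Ico h (Δ - 1)) = Δ - 1 - h := Nat.card_Ico _ _
        rw [← this]
        refine card_le_card fun b hb => ?_
        have := key b (mem_range.1 (mem_filter.1 hb).1) (mem_filter.1 hb).2
        exact mem_Ico.2 (by omega)
      · refine le_trans ?_ (le_max_left _ _)
        rw [← card_singleton a]
        refine card_le_card fun b hb => ?_
        have := key b (mem_range.1 (mem_filter.1 hb).1) (mem_filter.1 hb).2
        exact mem_singleton.2 (by omega)
    · intro hh a ha
      simp only [hmem]
      by_cases ha0 : a = 0
      · exact ⟨1, by omega, by omega⟩
      · exact ⟨0, by omega, by omega⟩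

/-- In a regular relation of positive degree, every vertex can be sent injectively to a related
one. -/
theorem exists_injOn_of_regular {C : Finset V} {R : V → V → Prop} {f : ℕ} (hf : 1 ≤ f)
    (hsymm : ∀ x y, R x y → R y x) (hR : ∀ x ∈ C, #{y ∈ C | R x y} = f) :
    ∃ π : V → V, Set.InjOn π C ∧ ∀ x ∈ C, π x ∈ C ∧ R x (π x) := by
  have hall : ∀ S : Finset C, #S ≤ #(S.biUnion fun x => ({y ∈ C | R x y} : Finset V)) := by
    intro S
    refine Nat.le_of_mul_le_mul_right ?_ hf
    refine card_mul_le_card_mul (fun (x : C) (y : V) => R x y) ?_ ?_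
    · intro x hx
      rw [← hR x x.2]
      refine card_le_card fun y hy => ?_
      rw [mem_bipartiteAbove]
      exact ⟨mem_biUnion.2 ⟨x, hx, hy⟩, (mem_filter.1 hy).2⟩
    · intro y hy
      obtain ⟨x, hx, hxy⟩ := mem_biUnion.1 hy
      rw [← hR y (mem_filter.1 hxy).1, ← card_map (Function.Embedding.subtype _)]
      refine card_le_card fun z hz => ?_
      simp only [mem_map, mem_bipartiteBelow, Function.Embedding.coe_subtype] at hz
      obtain ⟨w, ⟨-, hw⟩, rfl⟩ := hz
      exact mem_filter.2 ⟨w.2, hsymm _ _ hw⟩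
  obtain ⟨g, hg, hg'⟩ := (Finset.all_card_le_biUnion_card_iff_exists_injective _).1 hall
  refine ⟨fun x => if hx : x ∈ C then g ⟨x, hx⟩ else x, ?_, ?_⟩
  · intro x hx y hy hxy
    simp only [mem_coe] at hx hy
    simp only [hx, hy, dite_true] at hxy
    simpa using hg hxy
  · intro x hx
    simp only [hx, dite_true]
    simpa using hg' ⟨x, hx⟩

/-- If `π` moves every vertex of `C` to a related one, there is a labelling for which every vertex
is equal or related to one with a complementary label. -/
theorem exists_label_of_injOn {C : Finset V} {π : V → V} (hinj : Set.InjOn π C)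
    (hπ : ∀ x ∈ C, π x ∈ C ∧ π x ≠ x) : ∃ ℓ, Label C ℓ ∧
      ∀ x ∈ C, 2 * ℓ x < #C ∨ (∃ z ∈ C, π z = x ∧ ℓ x + ℓ z < #C) ∨ ℓ x + ℓ (π x) < #C := by
  rcases C.eq_empty_or_nonempty with rfl | ⟨x₀, -⟩
  · exact ⟨fun _ => 0, ⟨by simp, by simp⟩, by simp⟩
  have : Nonempty V := ⟨x₀⟩
  obtain ⟨Z, hZ, hmax⟩ := (C.powerset.filter fun Z => Disjoint Z (Z.image π)).exists_maximal
    ⟨∅, by simp⟩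
  simp only [mem_filter, mem_powerset] at hZ hmax
  obtain ⟨hZC, hdis⟩ := hZ
  have himC : Z.image π ⊆ C := by
    intro x hx
    obtain ⟨z, hz, rfl⟩ := mem_image.1 hx
    exact (hπ z (hZC hz)).1
  have hcard : 2 * #Z ≤ #C := by
    have := card_le_card (union_subset hZC himC)
    rw [card_union_of_disjoint hdis, card_image_of_injOn (hinj.mono (coe_subset.2 hZC))] at this
    omega
  obtain ⟨q, hq⟩ := exists_index Z
  obtain ⟨f, hf1, hf2⟩ : ∃ f : V → ℕ, (∀ z ∈ Z, f z = q z) ∧ ∀ z ∈ Z, f (π z) + q z + 1 = #C := by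
    refine ⟨fun x => if x ∈ Z then q x else #C - 1 - q (Function.invFunOn π Z x), ?_, ?_⟩
    · intro z hz; simp [hz]
    · intro z hz
      have h1 : π z ∉ Z := fun h => Finset.disjoint_left.1 hdis h (mem_image_of_mem _ hz)
      have h2 : Function.invFunOn π Z (π z) = z :=
        (hinj.mono (coe_subset.2 hZC)).leftInvOn_invFunOn hz
      have := hq.lt z hz
      simp only [h1, if_false, h2]
      omega
  obtain ⟨ℓ, hℓ, hℓf⟩ := exists_label (C := C) (s := Z ∪ Z.image π) (f := f)
    (union_subset hZC himC) (by
      intro x hx y hy hxy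
      simp only [coe_union, coe_image, Set.mem_union, Set.mem_image, mem_coe] at hx hy
      rcases hx with hx | ⟨x, hx, rfl⟩ <;> rcases hy with hy | ⟨y, hy, rfl⟩
      · rw [hf1 x hx, hf1 y hy] at hxy
        exact hq.inj hx hy hxy
      · have := hf1 x hx; have := hf2 y hy; have := hq.lt x hx; have := hq.lt y hy
        omega
      · have := hf1 y hy; have := hf2 x hx; have := hq.lt x hx; have := hq.lt y hy
        omega
      · have := hf2 x hx; have := hf2 y hy
        rw [hq.inj hx hy (by omega)])
    (by
      intro x hx
      rcases mem_union.1 hx with hx | hx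
      · have := hf1 x hx; have := hq.lt x hx; omega
      · obtain ⟨z, hz, rfl⟩ := mem_image.1 hx
        have := hf2 z hz; omega)
  have hℓ1 : ∀ z ∈ Z, ℓ z = q z := fun z hz => by
    rw [hℓf z (mem_union_left _ hz), hf1 z hz]
  have hℓ2 : ∀ z ∈ Z, ℓ (π z) + q z + 1 = #C := fun z hz => by
    rw [hℓf _ (mem_union_right _ (mem_image_of_mem _ hz)), hf2 z hz]
  refine ⟨ℓ, hℓ, fun x hx => ?_⟩
  by_cases hxZ : x ∈ Z
  · left
    have := hℓ1 x hxZ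
    have := hq.lt x hxZ
    omega
  by_cases hxI : x ∈ Z.image π
  · obtain ⟨z, hz, rfl⟩ := mem_image.1 hxI
    refine Or.inr (Or.inl ⟨z, hZC hz, rfl, ?_⟩)
    have := hℓ1 z hz
    have := hℓ2 z hz
    omega
  right; right
  have hπZ : π x ∈ Z := by
    by_contra hcon
    have h1 : Disjoint (insert x Z) ((insert x Z).image π) := by
      rw [image_insert, disjoint_insert_left, disjoint_insert_right]
      refine ⟨?_, hcon, hdis⟩
      rw [mem_insert, not_or]
      exact ⟨(hπ x hx).2.symm, hxI⟩
    exact hxZ (hmax ⟨insert_subset hx hZC, h1⟩ (subset_insert _ _) (mem_insert_self _ _))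
  have h1 := hℓ1 _ hπZ
  have h2 := hq.lt _ hπZ
  by_contra! hcon
  obtain ⟨z, hz, hqz⟩ := hq.exists_eq (i := #C - 1 - ℓ x) (by have := hℓ.lt x hx; omega)
  have h3 := hℓ2 z hz
  have h4 := hℓ.lt x hx
  have : π z = x := hℓ.inj (hπ z (hZC hz)).1 hx (by omega)
  exact hxI (this ▸ mem_image_of_mem _ hz)

/-- A labelling in which every vertex has a non-neighbour of complementary label. -/
theorem exists_star_label {C : Finset V} {g : ℕ} (hg : ∀ x ∈ C, #(nbs G C x) = g)
    (hlt : g + 1 < #C) : ∃ ℓ, Label C ℓ ∧ ∀ x ∈ C, ∃ x' ∈ C, ¬ G.Adj x x' ∧ ℓ x + ℓ x' < #C := by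
  obtain ⟨R, hR⟩ : ∃ R : V → V → Prop, ∀ x y, R x y ↔ ¬ G.Adj x y ∧ y ≠ x :=
    ⟨_, fun _ _ => Iff.rfl⟩
  have hreg : ∀ x ∈ C, #{y ∈ C | R x y} = #C - g - 1 := by
    intro x hx
    have h1 := card_nonadj (G := G) (C := C) x
    have h2 : ({y ∈ C | R x y} : Finset V) = ({y ∈ C | ¬ G.Adj x y} : Finset V).erase x := by
      ext y
      simp only [mem_filter, mem_erase, hR]
      tauto
    rw [h2, card_erase_of_mem (by simp [hx]), ← h1, hg x hx]
    omega
  obtain ⟨π, hinj, hπ⟩ := exists_injOn_of_regular (by omega)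
    (fun x y h => by rw [hR] at h ⊢; exact ⟨fun h' => h.1 h'.symm, h.2.symm⟩) hreg
  obtain ⟨ℓ, hℓ, h⟩ := exists_label_of_injOn hinj fun x hx =>
    ⟨(hπ x hx).1, ((hR _ _).1 (hπ x hx).2).2⟩
  refine ⟨ℓ, hℓ, fun x hx => ?_⟩
  rcases h x hx with h | ⟨z, hz, rfl, h⟩ | h
  · exact ⟨x, hx, G.irrefl, by omega⟩
  · exact ⟨z, hz, fun h' => ((hR _ _).1 (hπ z hz).2).1 h'.symm, h⟩
  · exact ⟨_, (hπ x hx).1, ((hR _ _).1 (hπ x hx).2).1, h⟩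

/-- A labelling as in `exists_star_label` which moreover is central on `Q`. -/
theorem exists_star_label_window {C Q : Finset V} {g a : ℕ} (hg : ∀ x ∈ C, #(nbs G C x) = g)
    (hQ : Q ⊆ C) (hcard : #Q + 2 * a = #C) (hga : g < a) :
    ∃ ℓ, Label C ℓ ∧ (∀ x ∈ Q, a ≤ ℓ x ∧ ℓ x + a < #C) ∧
      ∀ x ∈ C, ∃ x' ∈ C, ¬ G.Adj x x' ∧ ℓ x + ℓ x' < #C := by
  obtain ⟨x₀, hx₀, hx₀Q⟩ : ∃ x ∈ C, x ∉ Q := by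
    by_contra! h
    have := card_le_card (show C ⊆ Q from h)
    omega
  obtain ⟨H, hH, hHc⟩ : ∃ H ⊆ (({y ∈ C | ¬ G.Adj x₀ y} : Finset V).erase x₀) \ Q, #H = g := by
    refine exists_subset_card_eq ?_
    have h1 := card_nonadj (G := G) (C := C) x₀
    have h2 := le_card_sdiff Q (({y ∈ C | ¬ G.Adj x₀ y} : Finset V).erase x₀)
    rw [card_erase_of_mem (by simp [hx₀])] at h2
    rw [hg x₀ hx₀] at h1
    omega
  have hH' : ∀ y ∈ H, y ∈ C ∧ ¬ G.Adj x₀ y ∧ y ≠ x₀ ∧ y ∉ Q := by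
    intro y hy
    have := hH hy
    simp only [mem_sdiff, mem_erase, mem_filter] at this
    tauto
  obtain ⟨q, hq⟩ := exists_index Q
  obtain ⟨p, hp⟩ := exists_index H
  obtain ⟨f, hf⟩ : ∃ f : V → ℕ, ∀ x, f x = if x ∈ Q then a + q x else
    if x ∈ H then #C - g + p x else 0 := ⟨_, fun _ => rfl⟩
  have hfQ : ∀ x ∈ Q, f x = a + q x := fun x hx => by rw [hf, if_pos hx]
  have hfH : ∀ x ∈ H, f x = #C - g + p x := fun x hx => by
    rw [hf, if_neg (hH' x hx).2.2.2, if_pos hx]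
  have hf0 : f x₀ = 0 := by
    rw [hf, if_neg hx₀Q, if_neg fun h => (hH' x₀ h).2.2.1 rfl]
  obtain ⟨ℓ, hℓ, hℓf⟩ := exists_label (C := C) (s := Q ∪ (H ∪ {x₀})) (f := f)
    (union_subset hQ (union_subset (fun y hy => (hH' y hy).1) (by simpa using hx₀)))
    (by
      intro x hx y hy hxy
      simp only [mem_coe, mem_union, mem_singleton] at hx hy
      rcases hx with hx | hx | rfl <;> rcases hy with hy | hy | rfl
      · rw [hfQ x hx, hfQ y hy] at hxy
        exact hq.inj hx hy (by omega)
      · have := hq.lt x hx; rw [hfQ x hx, hfH y hy] at hxy; omega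
      · rw [hfQ x hx, hf0] at hxy; omega
      · have := hq.lt y hy; rw [hfH x hx, hfQ y hy] at hxy; omega
      · rw [hfH x hx, hfH y hy] at hxy
        exact hp.inj hx hy (by omega)
      · rw [hfH x hx, hf0] at hxy; omega
      · rw [hf0, hfQ y hy] at hxy; omega
      · rw [hf0, hfH y hy] at hxy; omega
      · rfl)
    (by
      intro x hx
      simp only [mem_union, mem_singleton] at hx
      rcases hx with hx | hx | rfl
      · have := hq.lt x hx; rw [hfQ x hx]; omega
      · have := hp.lt x hx; rw [hfH x hx]; omega
      · rw [hf0]; omega)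
  refine ⟨ℓ, hℓ, fun x hx => ?_, fun x hx => ?_⟩
  · rw [hℓf x (by simp [hx]), hfQ x hx]
    have := hq.lt x hx
    omega
  · have hlx := hℓ.lt x hx
    by_cases hxg : #C ≤ ℓ x + g
    · obtain ⟨y, hy, hpy⟩ := hp.exists_eq (i := ℓ x + g - #C) (by omega)
      have hy' := hH' y hy
      have : y = x := hℓ.inj hy'.1 hx (by rw [hℓf y (by simp [hy]), hfH y hy]; omega)
      subst this
      refine ⟨x₀, hx₀, fun h => hy'.2.1 h.symm, ?_⟩
      rw [hℓf x₀ (by simp), hf0]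
      exact hlx
    · by_contra! hcon
      have h1 := hℓ.card_filter (fun i => ℓ x + i < #C)
      have h2 : ({i ∈ range #C | ℓ x + i < #C} : Finset ℕ) = range (#C - ℓ x) := by
        ext i; simp only [mem_filter, mem_range]; omega
      rw [h2, card_range] at h1
      have h3 : #{y ∈ C | ℓ x + ℓ y < #C} ≤ #(nbs G C x) := by
        refine card_le_card fun y hy => ?_
        have hy' := mem_filter.1 hy
        rw [mem_nbs]
        refine ⟨hy'.1, ?_⟩
        by_contra hadj
        have := hcon y hy'.1 fun h => hadj h.symm
        omega
      rw [hg x hx] at h3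
      omega

theorem stab_const {r : V} {b : Bool} {φ : G ≃g G} :
    Stab G (fun _ => b) {r} φ ↔ φ r = r := by
  simp [Stab]

theorem rigid_singleton (r : V) (c : Sym2 V → Bool) : Rigid G r c {r} := by
  rintro c' - φ hr - p rfl
  exact hr

theorem outdeg_singleton_of_adj {Δ : ℕ} (hreg : G.IsRegularOfDegree Δ) {r x : V}
    (h : G.Adj r x) : outdeg G {r} x = Δ - 1 := by
  have : outdeg G {r} x = #((G.neighborFinset x).erase r) := by
    unfold outdeg
    congr 1
    ext u
    simp only [mem_filter, mem_erase, Set.mem_singleton_iff]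
    tauto
  rw [this, card_erase_of_mem (by simpa using h.symm), card_neighborFinset_eq_degree,
    hreg x]

theorem outdeg_singleton_of_not_adj {Δ : ℕ} (hreg : G.IsRegularOfDegree Δ) {r x : V}
    (h : ¬ G.Adj r x) : outdeg G {r} x = Δ :=
  outdeg_eq_degree hreg (by simpa using h)

theorem one_le_outdeg_singleton {Δ : ℕ} (hΔ : 2 ≤ Δ) (hreg : G.IsRegularOfDegree Δ) (r x : V) :
    1 ≤ outdeg G {r} x := by
  by_cases h : G.Adj r x
  · rw [outdeg_singleton_of_adj hreg h]; omega
  · rw [outdeg_singleton_of_not_adj hreg h]; omega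

/-- The initial colouring when no vertex is equivalent to all other neighbours of the root. -/
theorem good_singleton {Δ : ℕ} (hΔ : 2 ≤ Δ) (hreg : G.IsRegularOfDegree Δ) {r : V}
    (h : ∀ y, G.Adj r y →
      ∃ z, G.Adj r z ∧ z ∉ orbit G (fun _ => true) {r} y) :
    Good G r {r} {r} (fun _ => true) := by
  refine ⟨rfl, rigid_singleton r _, ?_, fun y _ => Or.inr (one_le_outdeg_singleton hΔ hreg r y),
    fun y hy hy' => absurd hy hy'⟩
  rintro y - ⟨p, rfl, hpy⟩
  obtain ⟨z, hz, hzy⟩ := h y hpy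
  refine le_trans ?_ (le_max_right _ _)
  rw [outdeg_singleton_of_adj hreg hpy, ← hreg p, ← card_neighborFinset_eq_degree,
    ← card_erase_of_mem ((G.mem_neighborFinset p z).2 hz), ← Set.ncard_coe_finset]
  refine Set.ncard_le_ncard ?_ (finite_toSet _)
  rintro w ⟨φ, hφ, rfl⟩
  simp only [coe_erase, Set.mem_sdiff, mem_coe, mem_neighborFinset, Set.mem_singleton_iff]
  refine ⟨?_, fun h => hzy ⟨φ, hφ, h⟩⟩
  rw [← stab_const.1 hφ, φ.map_adj_iff]
  exact hpy

/-- The initial colouring when the root has many twins. -/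
theorem exists_good_of_twins {Δ : ℕ} (hΔ : 4 ≤ Δ) (hreg : G.IsRegularOfDegree Δ) {r : V}
    {D : Finset V} (hD : ∀ y, y ∈ D ↔ y ≠ r ∧ ∀ x, G.Adj y x ↔ G.Adj r x) (hh : 2 ≤ #D)
    (hne : ¬ (Δ = 4 ∧ #D = 2)) :
    ∃ c : Sym2 V → Bool, Agree (fun _ => true) c {r} ∧ Good G r {r} ({r} ∪ D) c := by
  have hcard : ∀ y, #(G.neighborFinset y) = Δ := fun y => by
    rw [card_neighborFinset_eq_degree, hreg y]
  have hadj : ∀ y ∈ D, ∀ x, G.Adj y x ↔ G.Adj r x := fun y hy => ((hD y).1 hy).2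
  have hrD : r ∉ D := fun h => ((hD r).1 h).1 rfl
  have hlt : #D < Δ := by
    obtain ⟨x, hx⟩ := card_pos.1 (by rw [hcard r]; omega : 0 < #(G.neighborFinset r))
    rw [mem_neighborFinset] at hx
    rw [Nat.lt_iff_add_one_le, ← card_insert_of_notMem hrD, ← hcard x]
    refine card_le_card fun y hy => ?_
    rw [mem_neighborFinset]
    rcases mem_insert.1 hy with rfl | hy
    · exact hx.symm
    · exact ((hadj y hy x).2 hx).symm
  obtain ⟨F, hF1, hF2, hF3, hF4⟩ := exists_family hΔ hh hlt hne
  obtain ⟨q, hq⟩ := exists_index D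
  obtain ⟨p, hp⟩ := exists_index (G.neighborFinset r)
  obtain ⟨ρ, hρ⟩ : ∃ ρ : V → V → Prop, ∀ y x, ρ y x ↔ p x ∈ F (q y) := ⟨_, fun _ _ => Iff.rfl⟩
  obtain ⟨W, hW⟩ : ∃ W : Set V, W = ({r} : Set V)ᶜ := ⟨_, rfl⟩
  have hmemW : ∀ y, y ∈ W ↔ y ≠ r := fun y => by rw [hW]; simp
  have hcount : ∀ y ∈ D, #{x ∈ G.neighborFinset y | x ∈ W ∧ ρ y x} = #(F (q y)) := by
    intro y hy
    have h1 := hp.card_filter (fun i => i ∈ F (q y))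
    have h2 := (hF1 _ (hq.lt y hy)).1
    rw [hcard r, filter_mem_eq_inter, inter_eq_right.2 h2] at h1
    rw [← h1]
    congr 1
    ext x
    simp only [mem_filter, mem_neighborFinset, hmemW, hρ, hadj y hy]
    constructor
    · rintro ⟨h1, -, h2⟩; exact ⟨h1, h2⟩
    · rintro ⟨h1, h2⟩; exact ⟨h1, h1.ne', h2⟩
  have hN : ∀ y, (∃ x ∈ D, G.Adj x y) → G.Adj r y := by
    rintro y ⟨x, hx, hxy⟩; exact (hadj x hx y).1 hxy
  have hall : ∀ y, G.Adj r y → #{x ∈ D | G.Adj x y} = #D := by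
    intro y hy
    rw [filter_true_of_mem fun x hx => (hadj x hx y).2 hy]
  have hpN : ∀ y, G.Adj r y → p y < Δ := fun y hy => by
    rw [← hcard r]; exact hp.lt y (by simpa using hy)
  refine Exists.imp ?_ (good_union (G := G) (r := r) (P₀ := {r}) (P := {r}) (W := W)
    (c := fun _ => true) (C := D) (ρ := ρ) (by simpa using hrD) ?_ rfl (rigid_singleton r _)
    ?_ ?_ (fun y hy hy' => absurd hy hy') ?_ (hW ▸ invariant_compl _ _)
    (hW ▸ disjoint_compl_right) ?_ ?_ ?_ ?_)
  · rintro c ⟨h1, h2, -⟩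
    exact ⟨h1, h2⟩
  · intro φ hφ y hy
    rw [stab_const] at hφ
    rw [mem_coe, hD] at hy ⊢
    refine ⟨fun h => hy.1 (φ.injective (h.trans hφ.symm)), fun x => ?_⟩
    have h1 := φ.map_adj_iff (v := y) (w := φ.symm x)
    have h2 := φ.map_adj_iff (v := r) (w := φ.symm x)
    rw [RelIso.apply_symm_apply] at h1 h2
    rw [h1, hy.2, ← h2, hφ]
  · rintro y - - h ⟨x, rfl, hxy⟩
    obtain ⟨d, hd⟩ := card_pos.1 (by omega : 0 < #D)
    exact absurd ((hadj d hd y).2 hxy) (h d hd)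
  · intro y _ _ _
    exact Or.inr (one_le_outdeg_singleton (by omega) hreg r y)
  · intro x hx y hy hxy
    exact absurd ((hadj y hy y).2 ((hadj x hx y).1 hxy)) G.irrefl
  · intro x hx y hy hxy
    simp only [hcount x hx, hcount y hy] at hxy
    exact hq.inj hx hy (hF2 _ (hq.lt x hx) _ (hq.lt y hy) hxy)
  · intro y _ hyD hy
    rw [hall y (hN y hy), outdeg_singleton_of_adj hreg (hN y hy)]
    refine le_trans ?_ (hF3 (p y) (hpN y (hN y hy)))
    rw [← hcard r, ← hp.card_filter fun b => ∀ i < #D, (b ∈ F i ↔ p y ∈ F i),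
      ← Set.ncard_coe_finset]
    refine Set.ncard_le_ncard ?_ (finite_toSet _)
    rintro z ⟨-, hz⟩
    simp only [coe_filter, Set.mem_ofPred_eq, mem_neighborFinset]
    constructor
    · obtain ⟨d, hd, hdy⟩ := hy
      exact hN z ⟨d, hd, (hz d hd).1.2 hdy⟩
    · intro i hi
      obtain ⟨d, hd, rfl⟩ := hq.exists_eq hi
      rw [← hρ, ← hρ]
      exact (hz d hd).2 ((hadj d hd y).2 (hN y hy))
  · intro y _ hyD hy
    rw [hall y (hN y hy), outdeg_singleton_of_adj hreg (hN y hy)]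
    by_cases h : #D = Δ - 1
    · left
      obtain ⟨i, hi, hi'⟩ := hF4 h (p y) (hpN y (hN y hy))
      obtain ⟨d, hd, rfl⟩ := hq.exists_eq hi
      exact ⟨d, hd, (hadj d hd y).2 (hN y hy), by rwa [hρ]⟩
    · right; omega
  · intro d hd _
    right
    by_contra! hcon
    have h1 := (hF1 _ (hq.lt d hd)).2
    rw [← hcount d hd] at h1
    refine h1.not_ge ?_
    rw [← hcard d]
    refine card_le_card fun x hx => ?_
    rw [mem_neighborFinset] at hx
    have hxr : x ≠ r := by
      rintro rfl; exact G.irrefl ((hadj d hd x).1 hx)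
    simp only [mem_filter, mem_neighborFinset, hmemW]
    exact ⟨hx, hxr, hcon x (by simpa using hxr) hx⟩

theorem pre_root {r : V} (P₀ : Set V) (hP₀ : r ∈ P₀) {Δ : ℕ} (hΔ : 2 ≤ Δ)
    (hreg : G.IsRegularOfDegree Δ)
    (hC : IsOrbit G (fun _ => true) {r} (G.neighborFinset r)) :
    Pre G r P₀ {r} (fun _ => true) (G.neighborFinset r) := by
  refine ⟨by simp, hC, rfl, rigid_singleton r _, ?_,
    fun y _ _ _ => Or.inr (one_le_outdeg_singleton hΔ hreg r y), ?_⟩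
  · rintro y - hyC - ⟨p, rfl, hpy⟩
    exact absurd ((G.mem_neighborFinset p y).2 hpy) hyC
  · rintro y rfl hy
    exact absurd hP₀ hy

theorem card_nbs_eq {c : Sym2 V → Bool} {P : Set V} {C : Finset V} (hC : IsOrbit G c P C) :
    ∃ g, ∀ x ∈ C, #(nbs G C x) = g := by
  obtain ⟨x₀, hx₀⟩ := hC.1
  refine ⟨#(nbs G C x₀), fun x hx => ?_⟩
  obtain ⟨φ, hφ, rfl⟩ := hC.exists_map hx₀ hx
  rw [nbs_map hC.invariant hφ, card_image_of_injective _ φ.injective]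

/-- In a connected graph which is not complete, no neighbourhood is a clique separated from the
rest of the graph. -/
theorem lt_of_not_complete {Δ : ℕ} (hconn : G.Connected) (hreg : G.IsRegularOfDegree Δ)
    (hnc : ¬ ∀ u v : V, u ≠ v → G.Adj u v) {r : V} {g : ℕ} (hΔ : 1 ≤ Δ)
    (hg : ∀ x ∈ G.neighborFinset r, #(nbs G (G.neighborFinset r) x) = g) : g + 1 < Δ := by
  by_contra! hle
  refine hnc ?_
  have hcl : ∀ x, G.Adj r x → ∀ u, u ≠ x → (u = r ∨ G.Adj r u) → G.Adj x u := by
    intro x hx u hux hu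
    rcases hu with rfl | hu
    · exact hx.symm
    · have h1 : nbs G (G.neighborFinset r) x = (G.neighborFinset r).erase x := by
        refine eq_of_subset_of_card_le ?_ ?_
        · intro v hv
          rw [mem_nbs] at hv
          exact mem_erase.2 ⟨hv.2.ne, hv.1⟩
        · rw [hg x (by simpa using hx), card_erase_of_mem (by simpa using hx),
            card_neighborFinset_eq_degree, hreg r]
          omega
      have h2 : u ∈ nbs G (G.neighborFinset r) x := by
        rw [h1]; exact mem_erase.2 ⟨hux, by simpa using hu⟩
      exact (mem_nbs.1 h2).2.symm
  have huniv : ∀ v, v = r ∨ G.Adj r v := by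
    by_contra! hcon
    obtain ⟨v, hv⟩ := hcon
    obtain ⟨p, hp, y, hy, hpy⟩ := exists_adj_notMem (r := r) (P := {v | v = r ∨ G.Adj r v}) hconn
      (Or.inl rfl) (by
        intro h
        have : v ∈ {v | v = r ∨ G.Adj r v} := h ▸ Set.mem_univ v
        rcases this with h | h
        · exact hv.1 h
        · exact hv.2 h)
    rcases hp with rfl | hp
    · exact hy (Or.inr hpy)
    · have hsub : insert r ((G.neighborFinset r).erase p) ⊆ (G.neighborFinset p).erase y := by
        intro u hu
        rw [mem_insert, mem_erase, mem_neighborFinset] at hu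
        rw [mem_erase, mem_neighborFinset]
        refine ⟨?_, hcl p hp u ?_ (hu.imp_right And.right)⟩
        · rintro rfl
          exact hy (hu.imp_right And.right)
        · rcases hu with rfl | hu
          · exact hp.ne
          · exact hu.1
      have := card_le_card hsub
      rw [card_insert_of_notMem (by simp), card_erase_of_mem (by simpa using hp),
        card_erase_of_mem (by simpa using hpy), card_neighborFinset_eq_degree,
        card_neighborFinset_eq_degree, hreg r, hreg p] at this
      omega
  intro u v huv
  rcases huniv u with rfl | hu
  · exact (huniv v).resolve_left huv.symm
  · exact hcl u hu v huv.symm (huniv v)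

/-- The colourings constructed around a root with equivalent neighbours. -/
def RootLabelled (G : SimpleGraph V) [G.LocallyFinite] (r : V) : Prop :=
  ∃ ℓ x, ∃ c : Sym2 V → Bool, Label (G.neighborFinset r) ℓ ∧ G.Adj r x ∧
    ℓ x + 1 = G.degree r ∧ Agree (fun _ => true) c {r} ∧
    Good G r {r, x} ({r} ∪ G.neighborFinset r) c ∧
    ∀ y, G.Adj r y → #{z ∈ G.neighborFinset y | z ∉ ({r} : Set V) ∧ c s(y, z) = true} = ℓ y

theorem rootLabelled_of_forall {Δ : ℕ} (hΔ : 2 ≤ Δ) (hreg : G.IsRegularOfDegree Δ) {r : V}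
    (hC : IsOrbit G (fun _ => true) {r} (G.neighborFinset r)) {ℓ : V → ℕ}
    (hℓ : Label (G.neighborFinset r) ℓ)
    (hstar : ∀ x ∈ G.neighborFinset r, ∃ x' ∈ G.neighborFinset r,
      ¬ G.Adj x x' ∧ ℓ x + ℓ x' < #(G.neighborFinset r))
    (h : ∀ P₀, Pre G r P₀ {r} (fun _ => true) (G.neighborFinset r) →
      (∀ x ∈ G.neighborFinset r, ℓ x + 0 ≤
        innerRed G (G.neighborFinset r) ℓ x + #(outside G {r} (G.neighborFinset r) x)) →
      (∀ y ∉ ({r} : Set V), y ∉ G.neighborFinset r → (∃ x ∈ G.neighborFinset r, G.Adj x y) →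
        (∃ x ∈ G.neighborFinset r, G.Adj x y ∧ ℓ x + 0 = 0) ∨
          #(nbs G (G.neighborFinset r) y) < outdeg G {r} y) →
      (∀ x ∈ G.neighborFinset r, x ∉ P₀ → ℓ x + 0 < outdeg G {r} x) →
      ∃ c : Sym2 V → Bool, Agree (fun _ => true) c {r} ∧
        Good G r P₀ ({r} ∪ G.neighborFinset r) c ∧ ∀ y ∈ G.neighborFinset r,
          #{z ∈ G.neighborFinset y | z ∉ ({r} : Set V) ∧ c s(y, z) = true} = ℓ y + 0) :
    RootLabelled G r := by
  have hcard : #(G.neighborFinset r) = Δ := by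
    rw [card_neighborFinset_eq_degree, hreg r]
  obtain ⟨x, hx, hxΔ⟩ := hℓ.exists_eq (i := Δ - 1) (by omega)
  have hpre := pre_root {r, x} (by simp) hΔ hreg hC
  have h1 : ∀ x ∈ G.neighborFinset r, ℓ x + 0 ≤
      innerRed G (G.neighborFinset r) ℓ x + #(outside G {r} (G.neighborFinset r) x) := by
    intro x hx
    have h1 := lt_innerRed hℓ hx (hstar x hx)
    have h2 := card_outside (G := G) hpre.disj x
    rw [outdeg_singleton_of_adj hreg (by simpa using hx)] at h2
    omega
  have h2 : ∀ y ∉ ({r} : Set V), y ∉ G.neighborFinset r →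
      (∃ x ∈ G.neighborFinset r, G.Adj x y) →
      (∃ x ∈ G.neighborFinset r, G.Adj x y ∧ ℓ x + 0 = 0) ∨
        #(nbs G (G.neighborFinset r) y) < outdeg G {r} y := by
    intro y _ hyC _
    rw [outdeg_singleton_of_not_adj hreg (by simpa using hyC)]
    by_cases hfull : nbs G (G.neighborFinset r) y = G.neighborFinset r
    · obtain ⟨z, hz, hz0⟩ := hℓ.exists_eq (i := 0) (by omega)
      exact Or.inl ⟨z, hz, nbs_eq_self.1 hfull z hz, by omega⟩
    · right
      rw [← hcard]
      exact card_lt_card (lt_of_le_of_ne (filter_subset _ _) hfull)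
  have h3 : ∀ z ∈ G.neighborFinset r, z ∉ ({r, x} : Set V) → ℓ z + 0 < outdeg G {r} z := by
    intro z hz hzx
    rw [outdeg_singleton_of_adj hreg (by simpa using hz)]
    have h4 := hℓ.lt z hz
    have h5 : ℓ z ≠ ℓ x := fun h => hzx (Or.inr (hℓ.inj hz hx h))
    omega
  obtain ⟨c, hc, hg, hcount⟩ := h {r, x} hpre h1 h2 h3
  refine ⟨ℓ, x, c, hℓ, by simpa using hx, by rw [hreg r]; omega, hc, hg, fun y hy => ?_⟩
  exact hcount y (by simpa using hy)

/-- The case where distinct twins of the root are inequivalent. -/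
theorem rootLabelled_of_fixed {Δ : ℕ} (hΔ : 2 ≤ Δ) (hconn : G.Connected)
    (hreg : G.IsRegularOfDegree Δ) (hnc : ¬ ∀ u v : V, u ≠ v → G.Adj u v) {r : V}
    (hC : IsOrbit G (fun _ => true) {r} (G.neighborFinset r))
    (htwin : ∀ y ≠ r, nbs G (G.neighborFinset r) y = G.neighborFinset r →
      (orbit G (fun _ => true) {r} y).ncard ≤ 1) : RootLabelled G r := by
  have hcard : #(G.neighborFinset r) = Δ := by
    rw [card_neighborFinset_eq_degree, hreg r]
  obtain ⟨g, hg⟩ := card_nbs_eq hC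
  have hgΔ := lt_of_not_complete hconn hreg hnc (by omega) hg
  have hblock : ∀ D : Finset V, (∀ D' s k e β, BadOrbit G (fun _ => true) {r} Δ
        (G.neighborFinset r) D' s k e β → ∀ y ∈ D', y ∈ D) →
      ∀ y ∉ ({r} : Set V), y ∉ G.neighborFinset r → y ∉ D →
        (∃ x ∈ G.neighborFinset r, G.Adj x y) →
        {z ∈ orbit G (fun _ => true) {r} y |
          nbs G (G.neighborFinset r) z = nbs G (G.neighborFinset r) y}.ncard ≤
        max 1 (outdeg G {r} y - #(nbs G (G.neighborFinset r) y)) := by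
    intro D hD y hyP hyC hyD hy
    by_cases hfull : nbs G (G.neighborFinset r) y = G.neighborFinset r
    · refine le_trans (le_trans (Set.ncard_le_ncard (fun z hz => hz.1)
        (orbit_finite_of_adj hC.invariant hy)) (htwin y hyP hfull)) (le_max_left _ _)
    · by_contra hcon
      obtain ⟨D', s', k', e', β', hb', hy'⟩ := exists_badOrbit hC hcard.le hyP hyC hy
        (card_lt_card (lt_of_le_of_ne (filter_subset _ _) hfull))
        (Or.inl (outdeg_singleton_of_not_adj hreg (by simpa using hyC))) hcon
      exact hyD (hD _ _ _ _ _ hb' y hy')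
  by_cases hbad : ∃ D s k e β, BadOrbit G (fun _ => true) {r} Δ (G.neighborFinset r) D s k e β
  · obtain ⟨D, s, k, e, β, hb⟩ := hbad
    obtain ⟨Q, hQC, hQne, hQ, hhit⟩ := hb.exists_hitting hreg hC.1
    have hga : g < Δ - 1 - k * (Δ - β) := by
      obtain ⟨x, hx⟩ := hC.1
      have hpre := pre_root {r} rfl hΔ hreg hC
      have h2 := card_outside (G := G) hpre.disj x
      rw [outdeg_singleton_of_adj hreg (by simpa using hx), hg x hx] at h2
      have h1 : #{z ∈ D | G.Adj x z} ≤ #(outside G {r} (G.neighborFinset r) x) := by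
        refine card_le_card fun z hz => ?_
        have hz' := mem_filter.1 hz
        exact mem_outside.2 ⟨hz'.2, hb.notMem z hz'.1⟩
      rw [hb.inc.card_adj x hx] at h1
      have := hb.add_le
      have := hb.k_pos
      omega
    obtain ⟨ℓ, hℓ, hwin, hstar⟩ := exists_star_label_window hg hQC hQ hga
    refine rootLabelled_of_forall hΔ hreg hC hℓ hstar fun P₀ hpre h1 h2 h3 => ?_
    exact hpre.exists_good_of_bad hb (by omega) hQC hQne hhit hℓ hwin
      (fun x hx => by rw [outdeg_singleton_of_adj hreg (by simpa using hx)]; omega) h1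
      (hblock D fun D' s' k' e' β' hb' y hy => hb.mem_of_bad hreg hC.1 hcard.le hb' hy) h2 h3
  · obtain ⟨ℓ, hℓ, hstar⟩ := exists_star_label hg (by omega)
    refine rootLabelled_of_forall hΔ hreg hC hℓ hstar fun P₀ hpre h1 h2 h3 => ?_
    exact hpre.exists_good_label (D := ∅) (Q := ∅) (hi := 0) hℓ h1
      (incidence_empty _) (by simp) (by simp) (by simp) (by simp) (by simp) (by simp) (by simp)
      (hblock ∅ fun D' s' k' e' β' hb' => absurd ⟨_, _, _, _, _, hb'⟩ hbad) h2 h3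

/-- The case of a root of degree four with two equivalent twins. -/
theorem rootLabelled_of_two_twins (hreg : G.IsRegularOfDegree 4) {r : V}
    (hC : IsOrbit G (fun _ => true) {r} (G.neighborFinset r)) {D : Finset V}
    (hD : ∀ y, y ∈ D ↔ y ≠ r ∧ nbs G (G.neighborFinset r) y = G.neighborFinset r)
    (hcard : #D = 2) (horb : IsOrbit G (fun _ => true) {r} D) : RootLabelled G r := by
  have hC4 : #(G.neighborFinset r) = 4 := by
    rw [card_neighborFinset_eq_degree, hreg r]
  have hadj : ∀ y ∈ D, ∀ x ∈ G.neighborFinset r, G.Adj x y := fun y hy =>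
    nbs_eq_self.1 ((hD y).1 hy).2
  have hDC : ∀ y ∈ D, y ∉ G.neighborFinset r := fun y hy h => G.irrefl (hadj y hy y h)
  have hDadj : ∀ x ∈ G.neighborFinset r, #{z ∈ D | G.Adj x z} = 2 := fun x hx => by
    rw [filter_true_of_mem fun y hy => hadj y hy x hx, hcard]
  have hI : Incidence G (G.neighborFinset r) D 1 1 2 4 := by
    have hn : ∀ z ∈ D, nbs G (G.neighborFinset r) z = G.neighborFinset r :=
      fun z hz => ((hD z).1 hz).2
    have him : D.image (nbs G (G.neighborFinset r)) = {G.neighborFinset r} := by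
      rw [image_congr (g := fun _ => G.neighborFinset r) hn, image_const horb.1]
    refine ⟨fun z hz => by rw [hn z hz, hC4], fun z hz => ?_, by rw [him]; simp, by rw [hcard],
      fun x hx => ?_, fun x hx => by rw [hDadj x hx], by rw [hC4]⟩
    · rw [hn z hz, filter_true_of_mem hn, hcard]
    · rw [him, filter_true_of_mem (by simpa using hx), card_singleton]
  have hpre := pre_root {r} rfl (by omega) hreg hC
  have hg : ∀ x ∈ G.neighborFinset r, #(nbs G (G.neighborFinset r) x) ≤ 1 := by
    intro x hx
    have h2 := card_outside (G := G) hpre.disj x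
    rw [outdeg_singleton_of_adj hreg (by simpa using hx)] at h2
    have h1 : #{z ∈ D | G.Adj x z} ≤ #(outside G {r} (G.neighborFinset r) x) := by
      refine card_le_card fun z hz => ?_
      have hz' := mem_filter.1 hz
      exact mem_outside.2 ⟨hz'.2, ((hD z).1 hz'.1).1, hDC z hz'.1⟩
    rw [hDadj x hx] at h1
    omega
  obtain ⟨v, hv⟩ := hC.1
  obtain ⟨H, hH, hH2⟩ : ∃ H ⊆ ({y ∈ G.neighborFinset r | ¬ G.Adj v y} : Finset V).erase v,
      #H = 2 := by
    refine exists_subset_card_eq ?_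
    have h1 := card_nonadj (G := G) (C := G.neighborFinset r) v
    rw [card_erase_of_mem (by simpa using hv)]
    have := hg v hv
    omega
  have hH' : ∀ y ∈ H, y ∈ G.neighborFinset r ∧ ¬ G.Adj v y ∧ y ≠ v := by
    intro y hy
    have := hH hy
    rw [mem_erase, mem_filter] at this
    tauto
  obtain ⟨p, hp⟩ := exists_index H
  obtain ⟨ℓ, hℓ, hℓf⟩ := exists_label (C := G.neighborFinset r) (s := insert v H)
    (f := fun x => if x = v then 3 else p x)
    (insert_subset hv fun y hy => (hH' y hy).1)
    (by
      intro x hx y hy hxy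
      have hpx := hp.lt x
      have hpy := hp.lt y
      simp only [coe_insert, Set.mem_insert_iff, mem_coe] at hx hy
      rcases hx with rfl | hx <;> rcases hy with rfl | hy
      · rfl
      · simp only [if_true, (hH' y hy).2.2, if_false] at hxy
        have := hpy hy; omega
      · simp only [if_true, (hH' x hx).2.2, if_false] at hxy
        have := hpx hx; omega
      · simp only [(hH' x hx).2.2, (hH' y hy).2.2, if_false] at hxy
        exact hp.inj hx hy hxy)
    (by
      intro x hx
      have hpx := hp.lt x
      split_ifs with h
      · omega
      · have := hpx (mem_of_mem_insert_of_ne hx h); omega)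
  have hℓv : ℓ v = 3 := by rw [hℓf v (mem_insert_self _ _), if_pos rfl]
  have hℓH : ∀ y ∈ H, ℓ y = p y := fun y hy => by
    rw [hℓf y (mem_insert_of_mem hy), if_neg (hH' y hy).2.2]
  obtain ⟨a, ha, ha0⟩ := hp.exists_eq (i := 0) (by omega)
  obtain ⟨b, hb, hb1⟩ := hp.exists_eq (i := 1) (by omega)
  rw [← hℓH a ha] at ha0
  rw [← hℓH b hb] at hb1
  have hbC := (hH' b hb).1
  have hstar : ∀ x ∈ G.neighborFinset r, ∃ x' ∈ G.neighborFinset r,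
      ¬ G.Adj x x' ∧ ℓ x + ℓ x' < #(G.neighborFinset r) := by
    intro x hx
    have hlt := hℓ.lt x hx
    by_cases hx3 : ℓ x = 3
    · obtain rfl : x = v := hℓ.inj hx hv (by omega)
      exact ⟨a, (hH' a ha).1, (hH' a ha).2.1, by omega⟩
    · by_contra! hcon
      have h1 : #({a, b} : Finset V) ≤ #(nbs G (G.neighborFinset r) x) := by
        refine card_le_card fun y hy => ?_
        have hy' : y ∈ H ∧ ℓ y ≤ 1 := by
          rcases mem_insert.1 hy with rfl | hy
          · exact ⟨ha, by omega⟩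
          · rw [mem_singleton.1 hy]; exact ⟨hb, by omega⟩
        rw [mem_nbs]
        refine ⟨(hH' y hy'.1).1, ?_⟩
        by_contra hadj
        have := hcon y (hH' y hy'.1).1 fun h => hadj h.symm
        omega
      rw [card_pair (by rintro rfl; omega)] at h1
      have := hg x hx
      omega
  have hinner : innerRed G (G.neighborFinset r) ℓ b = 0 := by
    rw [innerRed, card_eq_zero, filter_eq_empty_iff]
    rintro y hy ⟨h1, h2⟩
    have := hℓ.lt y hy
    obtain rfl : y = v := hℓ.inj hy hv (by omega)
    exact (hH' b hb).2.1 h1.symm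
  refine rootLabelled_of_forall (by omega) hreg hC hℓ hstar fun P₀ hpre h1 h2 h3 => ?_
  refine hpre.exists_good_label (D := D) (Q := {b}) (hi := 1) hℓ h1 hI
    (fun y hy => ⟨((hD y).1 hy).1, hDC y hy, horb.2 y hy⟩) (by omega) (by omega)
    (by simpa using hbC) (fun y hy => ⟨b, by simp, hadj y hy b hbC⟩) ?_
    (fun y hy => le_max_left _ _) ?_ h2 h3
  · intro x hx
    rw [mem_singleton.1 hx, hinner, hb1]
    omega
  · intro y hyP hyC hyD hy
    by_contra hcon
    have hnf : nbs G (G.neighborFinset r) y ≠ G.neighborFinset r := fun h =>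
      hyD ((hD y).2 ⟨hyP, h⟩)
    obtain ⟨D', s', k', e', β', hb', hy'⟩ := exists_badOrbit hC hC4.le hyP hyC hy
      (card_lt_card (lt_of_le_of_ne (filter_subset _ _) hnf))
      (Or.inl (outdeg_singleton_of_not_adj hreg (by simpa using hyC))) hcon
    have h4 := card_adj_add_le (G := G) (horb.disjoint hb'.isOrbit hy' hyD) v
    rw [hDadj v hv, hb'.inc.card_adj v hv, hreg v] at h4
    have h5 := hb'.k_pos
    have h6 := hb'.lt_e
    have h7 := hb'.β_lt
    have h8 := hb'.inc.mul_eq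
    have h9 : k' * 2 ≤ k' * e' := Nat.mul_le_mul_left _ (by omega)
    obtain rfl : k' = 1 := by omega
    obtain rfl : β' = 3 := by omega
    omega

theorem Good.eq_id {r : V} {P₀ : Set V} {c : Sym2 V → Bool} (h : Good G r P₀ Set.univ c)
    (φ : G ≃g G) (hr : φ r = r)
    (hφ : ∀ e : G.edgeSet, c (φ.mapEdgeSet e) = c e) (v : V) : φ v = v :=
  h.rigid c (fun _ _ _ => rfl) φ hr (fun u w huw => hφ ⟨s(u, w), huw⟩) v (Set.mem_univ v)

theorem Good.allRedVertices_eq {r : V} {P₀ : Set V} {c : Sym2 V → Bool}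
    (h : Good G r P₀ Set.univ c) (hred : ∀ p ∈ P₀, ∀ u, G.Adj p u → c s(p, u) = true) :
    allRedVertices G (fun e => c e) = P₀ := by
  ext v
  constructor
  · intro hv
    by_contra hv0
    obtain ⟨u, hu, hc⟩ := h.blue_mem v (Set.mem_univ v) hv0
    have := hv ⟨s(v, u), hu⟩ (by simp)
    simp only [hc, Bool.false_eq_true] at this
  · rintro hv ⟨e, he⟩ hve
    obtain ⟨u, rfl⟩ := hve
    exact hred v hv u he

theorem redCount_eq (c : Sym2 V → Bool) (v : V) :
    redCount G (fun e => c e) v = #{u ∈ G.neighborFinset v | c s(v, u) = true} := by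
  rw [redCount, ← Set.ncard_coe_finset]
  congr 1
  ext u
  simp

theorem redCount_eq_add_one {r v : V} {c : Sym2 V → Bool} (hv : G.Adj r v)
    (hr : c s(r, v) = true) : redCount G (fun e => c e) v =
      #{u ∈ G.neighborFinset v | u ∉ ({r} : Set V) ∧ c s(v, u) = true} + 1 := by
  have hnot : r ∉ ({u ∈ G.neighborFinset v | u ∉ ({r} : Set V) ∧ c s(v, u) = true} : Finset V) := by
    simp
  rw [redCount_eq, ← card_insert_of_notMem hnot]
  congr 1
  ext u
  simp only [mem_filter, mem_insert, mem_neighborFinset, Set.mem_singleton_iff]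
  constructor
  · intro h
    by_cases hu : u = r
    · exact Or.inl hu
    · exact Or.inr ⟨h.1, hu, h.2⟩
  · rintro (rfl | h)
    · exact ⟨hv.symm, by rwa [Sym2.eq_swap]⟩
    · exact ⟨h.1, h.2.2⟩

/-- The properties required of a colouring. -/
def IsRootColouring (G : SimpleGraph V) (r : V) (Δ : ℕ) (c : G.edgeSet → Bool) : Prop :=
  (∀ φ : G ≃g G, φ r = r → (∀ e : G.edgeSet, c (φ.mapEdgeSet e) = c e) → ∀ v : V, φ v = v) ∧
    (allRedVertices G c = {r} ∨ ∃ x : V, G.Adj r x ∧ allRedVertices G c = {r, x}) ∧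
    ((∃ x : V, G.Adj r x ∧ allRedVertices G c = {r, x}) →
      ∀ k : ℕ, 1 ≤ k → k ≤ Δ → ∃ w : V, G.Adj r w ∧ redCount G c w = k)

theorem Good.exists_isRootColouring {Δ : ℕ} (hΔ : 2 ≤ Δ) (hconn : G.Connected)
    (hreg : G.IsRegularOfDegree Δ) {r : V} {P : Set V} {c : Sym2 V → Bool}
    (h : Good G r {r} P c) (hc : Agree (fun _ => true) c {r}) :
    ∃ c, IsRootColouring G r Δ c := by
  obtain ⟨c', hc', h'⟩ := h.exists_total hΔ hconn hreg
  have hred := h'.allRedVertices_eq (by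
    rintro p rfl u -
    rw [hc' _ h.root, hc _ rfl])
  refine ⟨fun e => c' e, fun φ hr hφ => h'.eq_id φ hr hφ, Or.inl hred, ?_⟩
  rintro ⟨x, hx, hx'⟩
  rw [hred] at hx'
  have : x ∈ ({r} : Set V) := hx' ▸ Or.inr rfl
  exact absurd this hx.ne'

theorem RootLabelled.exists_isRootColouring {Δ : ℕ} (hΔ : 2 ≤ Δ) (hconn : G.Connected)
    (hreg : G.IsRegularOfDegree Δ) {r : V} (h : RootLabelled G r) :
    ∃ c, IsRootColouring G r Δ c := by
  obtain ⟨ℓ, x, c, hℓ, hx, hxΔ, hc, hg, hcount⟩ := h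
  rw [hreg r] at hxΔ
  obtain ⟨c', hc', h'⟩ := hg.exists_total hΔ hconn hreg
  have hr : ∀ u, c' s(r, u) = true := fun u => by rw [hc' _ (Or.inl rfl), hc _ rfl]
  have hcount' : ∀ y, G.Adj r y → redCount G (fun e => c' e) y = ℓ y + 1 := by
    intro y hy
    rw [redCount_eq_add_one hy (hr y), ← hcount y hy]
    congr 2
    refine filter_congr fun u _ => ?_
    rw [hc' y (Or.inr (by simpa using hy))]
  have hred := h'.allRedVertices_eq (by
    rintro p (rfl | rfl) u hu
    · exact hr u
    · have h1 := hcount' p hx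
      rw [hxΔ, redCount_eq, ← hreg p, ← card_neighborFinset_eq_degree,
        card_filter_eq_iff] at h1
      exact h1 u (by simpa using hu))
  refine ⟨fun e => c' e, fun φ hr hφ => h'.eq_id φ hr hφ, Or.inr ⟨x, hx, hred⟩, ?_⟩
  intro _ k hk hkΔ
  obtain ⟨w, hw, hwk⟩ := hℓ.exists_eq (i := k - 1) (by
    rw [card_neighborFinset_eq_degree, hreg r]; omega)
  rw [mem_neighborFinset] at hw
  exact ⟨w, hw, by rw [hcount' w hw]; omega⟩

theorem exists_isRootColouring {Δ : ℕ} (hΔ : 4 ≤ Δ) (hconn : G.Connected)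
    (hreg : G.IsRegularOfDegree Δ) (hnc : ¬ ∀ u v : V, u ≠ v → G.Adj u v) (r : V) :
    ∃ c, IsRootColouring G r Δ c := by
  have hcard : ∀ y, #(G.neighborFinset y) = Δ := fun y => by
    rw [card_neighborFinset_eq_degree, hreg y]
  obtain ⟨x₀, hx₀⟩ := card_pos.1 (by rw [hcard r]; omega : 0 < #(G.neighborFinset r))
  obtain ⟨D, hD⟩ : ∃ D : Finset V, ∀ y, y ∈ D ↔
      y ≠ r ∧ nbs G (G.neighborFinset r) y = G.neighborFinset r := by
    refine ⟨{y ∈ G.neighborFinset x₀ |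
      y ≠ r ∧ nbs G (G.neighborFinset r) y = G.neighborFinset r}, fun y => ?_⟩
    rw [mem_filter, and_iff_right_iff_imp, mem_neighborFinset]
    exact fun h => nbs_eq_self.1 h.2 x₀ hx₀
  have hD' : ∀ y, y ∈ D ↔ y ≠ r ∧ ∀ x, G.Adj y x ↔ G.Adj r x := by
    intro y
    rw [hD, nbs_eq_self]
    refine and_congr_right fun _ => ⟨fun h x => ?_, fun h x hx => ?_⟩
    · have h1 : G.neighborFinset r = G.neighborFinset y := by
        refine eq_of_subset_of_card_le (fun x hx => ?_) (by rw [hcard, hcard])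
        simpa using (h x hx).symm
      rw [← mem_neighborFinset, ← h1, mem_neighborFinset]
    · exact ((h x).2 (by simpa using hx)).symm
  by_cases hmany : 2 ≤ #D ∧ ¬ (Δ = 4 ∧ #D = 2)
  · obtain ⟨c, hc, hg⟩ := exists_good_of_twins hΔ hreg hD' hmany.1 hmany.2
    exact hg.exists_isRootColouring (by omega) hconn hreg hc
  by_cases htrans : ∀ y, G.Adj r y → ∃ z, G.Adj r z ∧ z ∉ orbit G (fun _ => true) {r} y
  · exact (good_singleton (by omega) hreg htrans).exists_isRootColouring (by omega) hconn hreg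
      fun _ _ _ => rfl
  push Not at htrans
  obtain ⟨y, hy, hall⟩ := htrans
  have horb : orbit G (fun _ => true) {r} y = G.neighborFinset r := by
    ext z
    rw [mem_coe, mem_neighborFinset]
    refine ⟨?_, hall z⟩
    rintro ⟨φ, hφ, rfl⟩
    rw [← stab_const.1 hφ, φ.map_adj_iff]
    exact hy
  have hC : IsOrbit G (fun _ => true) {r} (G.neighborFinset r) := by
    refine ⟨⟨x₀, hx₀⟩, fun x hx => ?_⟩
    rw [← horb]
    exact orbit_eq (by rw [horb]; exact hx)
  have hsub : ∀ t ∈ D, orbit G (fun _ => true) {r} t ⊆ D := by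
    rintro t ht _ hz
    rw [mem_coe, hD]
    refine ⟨?_, nbs_eq_self_of_mem_orbit hC.invariant hz ((hD t).1 ht).2⟩
    have htP : t ∉ ({r} : Set V) := ((hD t).1 ht).1
    exact fun h => notMem_of_mem_orbit hz htP h
  by_cases hfix : ∀ t ≠ r, nbs G (G.neighborFinset r) t = G.neighborFinset r →
      (orbit G (fun _ => true) {r} t).ncard ≤ 1
  · exact (rootLabelled_of_fixed (by omega) hconn hreg hnc hC hfix).exists_isRootColouring
      (by omega) hconn hreg
  push Not at hfix
  obtain ⟨t, htr, htf, ht⟩ := hfix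
  have htD : t ∈ D := (hD t).2 ⟨htr, htf⟩
  have hle : (orbit G (fun _ => true) {r} t).ncard ≤ #D := by
    rw [← Set.ncard_coe_finset]
    exact Set.ncard_le_ncard (hsub t htD) (finite_toSet _)
  obtain ⟨rfl, hD2⟩ : Δ = 4 ∧ #D = 2 := by
    by_contra hcon
    exact hmany ⟨by omega, hcon⟩
  have heq : orbit G (fun _ => true) {r} t = D := by
    refine Set.eq_of_subset_of_ncard_le (hsub t htD) ?_ (finite_toSet _)
    rw [Set.ncard_coe_finset]
    omega
  have hDorb : IsOrbit G (fun _ => true) {r} D := by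
    refine ⟨⟨t, htD⟩, fun z hz => ?_⟩
    rw [← heq]
    exact orbit_eq (by rw [heq]; exact hz)
  exact (rootLabelled_of_two_twins hreg hC hD hD2 hDorb).exists_isRootColouring (by omega) hconn
    hreg

end RootedColouring

/-- Claim 5 of the paper: if `Δ ≥ 4` and `G` is a connected locally finite `Δ`-regular
simple graph which is not complete, then for any root `r` there is a red/blue edge colouring
`c` such that (i) the only automorphism fixing `r` and preserving `c` is the identity,
(ii) the vertices with all incident edges red form either `{r}` or `{r, x}` for some
neighbour `x` of `r`, and (iii) in the second case, for every `1 ≤ k ≤ Δ` the root `r`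
has a neighbour with exactly `k` incident red edges. -/
theorem stmt_4 {V : Type*} (G : SimpleGraph V) [G.LocallyFinite]
    (Δ : ℕ) (hΔ : 4 ≤ Δ) (hconn : G.Connected) (hreg : G.IsRegularOfDegree Δ)
    (hnotcomplete : ¬ ∀ u v : V, u ≠ v → G.Adj u v) (r : V) :
    ∃ c : G.edgeSet → Bool,
      (∀ φ : G ≃g G, φ r = r →
        (∀ e : G.edgeSet, c (φ.mapEdgeSet e) = c e) → ∀ v : V, φ v = v) ∧
      (allRedVertices G c = {r} ∨
        ∃ x : V, G.Adj r x ∧ allRedVertices G c = {r, x}) ∧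
      ((∃ x : V, G.Adj r x ∧ allRedVertices G c = {r, x}) →
        ∀ k : ℕ, 1 ≤ k → k ≤ Δ → ∃ w : V, G.Adj r w ∧ redCount G c w = k) := by
  exact RootedColouring.exists_isRootColouring hΔ hconn hreg hnotcomplete r
end

section
/- Let Δ ≥ 4 be a natural number, let G be a connected locally finite Δ-regular simple graph, and let r be a vertex of G. Suppose there exists an edge colouring c of G with colours red and blue such that: (i) the only automorphism of G that fixes r and preserves c is the identity; (ii) the set of vertices all of whose incident edges are red is either {r} or {r, x} for some neighbour x of r; and (iii) if this set has two elements, then for every k with 1 ≤ k ≤ Δ, r has a neighbour with exactly k incident red edges. Then G admits a distinguishing edge colouring with 2 colours, i.e. there is an edge colouring with two colours such that the only automorphism of G preserving it is the identity. -/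
open SimpleGraph

namespace EdgeColouring

variable {V : Type*} {G : SimpleGraph V}

/-- `v` and `u` are joined by a red edge. -/
def Red (c : G.edgeSet → Bool) (v u : V) : Prop :=
  ∃ h : G.Adj v u, c ⟨s(v, u), (G.mem_edgeSet).mpr h⟩ = true

/-- `φ` preserves the colouring `c`. -/
def Preserves (c : G.edgeSet → Bool) (φ : G ≃g G) : Prop :=
  ∀ e : G.edgeSet, c (φ.mapEdgeSet e) = c e

open scoped Classical in
/-- The colouring `c` with the edge `s(r, w)` recoloured blue. -/
noncomputable def recolour (c : G.edgeSet → Bool) (r w : V) : G.edgeSet → Bool :=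
  fun e => if (e : Sym2 V) = s(r, w) then false else c e

variable {c : G.edgeSet → Bool} {φ : G ≃g G}

lemma redCount_eq_ncard (v : V) : redCount G c v = {u | Red c v u}.ncard := rfl

lemma Red.adj {v u : V} (h : Red c v u) : G.Adj v u := h.1

lemma Red.symm {v u : V} (h : Red c v u) : Red c u v := by
  obtain ⟨h, hc⟩ := h
  refine ⟨h.symm, ?_⟩
  rw [← hc]
  congr 2
  exact Sym2.eq_swap

lemma red_recolour_iff {r w v u : V} :
    Red (recolour c r w) v u ↔ Red c v u ∧ s(v, u) ≠ s(r, w) := by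
  by_cases h : s(v, u) = s(r, w) <;> simp [Red, recolour, h]

lemma Preserves.red_iff (hφ : Preserves c φ) {v u : V} :
    Red c (φ v) (φ u) ↔ Red c v u := by
  constructor
  · rintro ⟨h, hc⟩
    have h' : G.Adj v u := φ.map_adj_iff.mp h
    exact ⟨h', (hφ ⟨s(v, u), h'⟩).symm.trans hc⟩
  · rintro ⟨h, hc⟩
    exact ⟨φ.map_adj_iff.mpr h, (hφ ⟨s(v, u), h⟩).trans hc⟩

lemma Preserves.redCount_apply (hφ : Preserves c φ) (v : V) :
    redCount G c (φ v) = redCount G c v := by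
  have himage : {u | Red c (φ v) u} = Set.image φ {u | Red c v u} := by
    ext u
    obtain ⟨u, rfl⟩ := φ.surjective u
    rw [φ.injective.mem_set_image]
    exact hφ.red_iff
  rw [redCount_eq_ncard, himage, Set.ncard_image_of_injective _ φ.injective, redCount_eq_ncard]

/-- A colour-preserving map for the recoloured graph fixing both ends of the recoloured edge
preserves the original colouring. -/
lemma Preserves.of_recolour {r w : V} (hφ : Preserves (recolour c r w) φ)
    (hr : φ r = r) (hw : φ w = w) : Preserves c φ := by
  intro e
  have hmap : ((φ.mapEdgeSet e : G.edgeSet) : Sym2 V) = Sym2.map φ e := rfl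
  have hrw : Sym2.map φ s(r, w) = s(r, w) := by simp [hr, hw]
  by_cases he : (e : Sym2 V) = s(r, w)
  · congr 1
    apply Subtype.ext
    rw [hmap, he, hrw]
  · have he' : ((φ.mapEdgeSet e : G.edgeSet) : Sym2 V) ≠ s(r, w) := by
      rw [hmap, ← hrw]
      exact fun h => he (Sym2.map.injective φ.injective h)
    have h := hφ e
    rwa [recolour, recolour, if_neg he, if_neg he'] at h

lemma mem_allRedVertices_iff {v : V} :
    v ∈ allRedVertices G c ↔ ∀ u, G.Adj v u → Red c v u := by
  constructor
  · exact fun h u hu => ⟨hu, h ⟨s(v, u), hu⟩ (Sym2.mem_mk_left v u)⟩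
  · rintro h ⟨e, he⟩ hv
    obtain ⟨u, rfl⟩ := Sym2.mem_iff_exists.mp hv
    exact (h u he).2

lemma redCount_recolour_of_ne {r w v : V} (hr : v ≠ r) (hw : v ≠ w) :
    redCount G (recolour c r w) v = redCount G c v := by
  simp [redCount_eq_ncard, red_recolour_iff, hr, hw]

lemma recolour_comm (r w : V) : recolour c r w = recolour c w r := by
  unfold recolour
  rw [Sym2.eq_swap]

section LocallyFinite

variable [G.LocallyFinite] {Δ : ℕ}

lemma finite_setOf_red (v : V) : {u | Red c v u}.Finite :=
  (G.neighborFinset v).finite_toSet.subset fun u hu => by simpa using hu.adj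

lemma redCount_add_ncard_blue (hreg : G.IsRegularOfDegree Δ) (v : V) :
    redCount G c v + {u | G.Adj v u ∧ ¬ Red c v u}.ncard = Δ := by
  have hfin : {u | G.Adj v u ∧ ¬ Red c v u}.Finite :=
    (G.neighborFinset v).finite_toSet.subset fun u hu => by simpa using hu.1
  rw [redCount_eq_ncard, ← Set.ncard_union_eq
    (Set.disjoint_left.mpr fun u hu hu' => hu'.2 hu) (finite_setOf_red v) hfin, ← hreg v,
    ← G.card_neighborFinset_eq_degree, ← Set.ncard_coe_finset]
  congr 1
  ext u
  simp only [Set.mem_union, Set.mem_ofPred_eq, coe_neighborFinset, mem_neighborSet]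
  exact ⟨fun h => h.elim Red.adj And.left, fun h => (em _).imp_right (⟨h, ·⟩)⟩

lemma redCount_le (hreg : G.IsRegularOfDegree Δ) (v : V) : redCount G c v ≤ Δ :=
  (Nat.le_add_right _ _).trans_eq (redCount_add_ncard_blue hreg v)

lemma redCount_eq_iff_mem_allRedVertices (hreg : G.IsRegularOfDegree Δ) {v : V} :
    redCount G c v = Δ ↔ v ∈ allRedVertices G c := by
  have hfin : {u | G.Adj v u ∧ ¬ Red c v u}.Finite :=
    (G.neighborFinset v).finite_toSet.subset fun u hu => by simpa using hu.1
  have h := redCount_add_ncard_blue (c := c) hreg v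
  have h0 := Set.ncard_eq_zero hfin
  rw [mem_allRedVertices_iff]
  constructor
  · intro hv u hu
    have := h0.mp (by omega)
    by_contra hn
    exact (Set.eq_empty_iff_forall_notMem.mp this) u ⟨hu, hn⟩
  · intro hv
    have := h0.mpr (Set.eq_empty_iff_forall_notMem.mpr fun u hu => hu.2 (hv u hu.1))
    omega

lemma redCount_recolour_add_one {r w : V} (h : Red c r w) :
    redCount G (recolour c r w) w + 1 = redCount G c w := by
  have hset : {u | Red (recolour c r w) w u} = {u | Red c w u} \ {r} := by
    ext u
    have hne : w ≠ r := h.adj.ne'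
    simp [red_recolour_iff, hne]
  rw [redCount_eq_ncard, redCount_eq_ncard, hset]
  exact Set.ncard_sdiff_singleton_add_one h.symm (finite_setOf_red w)

/-- If the neighbours of an all-red vertex realise all red counts from `1` to `Δ`, then each of
them is realised only once. -/
lemma redCount_injOn_neighborSet (hreg : G.IsRegularOfDegree Δ) {r : V}
    (hr : r ∈ allRedVertices G c)
    (h : ∀ k, 1 ≤ k → k ≤ Δ → ∃ w, G.Adj r w ∧ redCount G c w = k) :
    Set.InjOn (redCount G c) (G.neighborSet r) := by
  rw [← coe_neighborFinset]
  refine Finset.injOn_of_surjOn_of_card_le (t := Finset.Icc 1 Δ) _ ?_ ?_ ?_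
  · intro w hw
    have hw' : G.Adj r w := by simpa using hw
    have hpos : 0 < redCount G c w := (Set.ncard_pos (finite_setOf_red w)).mpr
      ⟨r, (mem_allRedVertices_iff.mp hr w hw').symm⟩
    exact Finset.mem_coe.mpr (Finset.mem_Icc.mpr ⟨hpos, redCount_le hreg w⟩)
  · intro k hk
    obtain ⟨hk1, hk2⟩ := Finset.mem_Icc.mp (Finset.mem_coe.mp hk)
    obtain ⟨w, hw, rfl⟩ := h k hk1 hk2
    exact ⟨w, by simpa using hw, rfl⟩
  · simp [hreg r]

/-- Suppose `r` and `x` are the only all-red vertices, `y` is the only neighbour of `x` with red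
count `Δ - 1`, and `y'` is the only blue neighbour of `y`. Recolouring an edge from `r` to a
neighbour `w` whose red count is suitably different from that of `y'` allows no automorphism
to move `r`. -/
lemma Preserves.fixes_of_recolour (hreg : G.IsRegularOfDegree Δ) {r x w y y' : V}
    (hred : allRedVertices G c = {r, x}) (hrx : G.Adj r x) (hrw : G.Adj r w) (hwx : w ≠ x)
    (hy : ∀ v, G.Adj x v → redCount G c v + 1 = Δ → v = y)
    (hy' : ∀ u, G.Adj y u → ¬ Red c y u → u = y')
    (hw : redCount G c w ≠ redCount G c y') (hw' : redCount G c w ≠ redCount G c y' + 1)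
    (hφ : Preserves (recolour c r w) φ) : φ r = r ∧ φ w = w := by
  have hr : r ∈ allRedVertices G c := by simp [hred]
  have hx : x ∈ allRedVertices G c := by simp [hred]
  have hRrw : Red c r w := mem_allRedVertices_iff.mp hr w hrw
  have hcw := redCount_recolour_add_one hRrw
  have hcr : redCount G (recolour c r w) r + 1 = Δ := by
    rw [recolour_comm, redCount_recolour_add_one hRrw.symm,
      (redCount_eq_iff_mem_allRedVertices hreg).mpr hr]
  have hcx : redCount G (recolour c r w) x = Δ := by
    rw [redCount_recolour_of_ne hrx.ne' hwx.symm, redCount_eq_iff_mem_allRedVertices hreg]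
    exact hx
  have hφx : φ x = x := by
    have h1 := hφ.redCount_apply x
    rw [hcx] at h1
    have hne : φ x ≠ r := by
      intro h
      rw [h] at h1
      omega
    have hnw : φ x ≠ w := by
      intro h
      have := redCount_le (c := c) hreg w
      rw [h] at h1
      omega
    rw [redCount_recolour_of_ne hne hnw, redCount_eq_iff_mem_allRedVertices hreg, hred] at h1
    exact h1.resolve_left hne
  have hblue : G.Adj (φ r) (φ w) ∧ ¬ Red (recolour c r w) (φ r) (φ w) := by
    refine ⟨φ.map_adj_iff.mpr hrw, ?_⟩
    rw [hφ.red_iff, red_recolour_iff]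
    simp
  have hφr : φ r = r := by
    by_contra hne
    have hadj : G.Adj x (φ r) := by
      rw [← hφx]
      exact φ.map_adj_iff.mpr hrx.symm
    have h1 := hφ.redCount_apply r
    have hnw : φ r ≠ w := by
      intro h
      rw [h] at h1
      have : w ∈ allRedVertices G c := (redCount_eq_iff_mem_allRedVertices hreg).mp (by omega)
      rw [hred] at this
      exact this.elim hrw.ne' hwx
    rw [redCount_recolour_of_ne hne hnw] at h1
    have hφry := hy _ hadj (by omega)
    have hφw : φ w = y' := by
      rw [hφry] at hblue hne hnw
      refine hy' _ hblue.1 fun h => hblue.2 (red_recolour_iff.mpr ⟨h, ?_⟩)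
      simp [hne, hnw]
    have h2 := hφ.redCount_apply w
    rw [hφw] at h2
    have hy'r : y' ≠ r := by
      intro h
      rw [hφw, h] at hblue
      have hR : Red c r (φ r) := mem_allRedVertices_iff.mp hr _ hblue.1.symm
      exact hblue.2 (red_recolour_iff.mpr ⟨hR.symm, by simp [hne, hnw]⟩)
    have hy'w : y' ≠ w := fun h => hw (by rw [h])
    rw [redCount_recolour_of_ne hy'r hy'w] at h2
    omega
  refine ⟨hφr, ?_⟩
  rw [hφr] at hblue
  by_contra hne
  refine hblue.2 (red_recolour_iff.mpr ⟨mem_allRedVertices_iff.mp hr _ hblue.1, ?_⟩)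
  simp [hne, hrw.ne]

end LocallyFinite

end EdgeColouring

open EdgeColouring in
/-- If `Δ ≥ 4`, `G` is a connected locally finite `Δ`-regular simple graph, `r` a vertex,
and there exists a red/blue edge colouring `c` with properties (i)–(iii) of Claim 5, then
`G` admits a distinguishing edge colouring with two colours. -/
theorem stmt_5 {V : Type*} (G : SimpleGraph V) [G.LocallyFinite]
    (Δ : ℕ) (hΔ : 4 ≤ Δ) (hconn : G.Connected) (hreg : G.IsRegularOfDegree Δ) (r : V)
    (hc : ∃ c : G.edgeSet → Bool,
      (∀ φ : G ≃g G, φ r = r →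
        (∀ e : G.edgeSet, c (φ.mapEdgeSet e) = c e) → ∀ v : V, φ v = v) ∧
      (allRedVertices G c = {r} ∨
        ∃ x : V, G.Adj r x ∧ allRedVertices G c = {r, x}) ∧
      ((∃ x : V, G.Adj r x ∧ allRedVertices G c = {r, x}) →
        ∀ k : ℕ, 1 ≤ k → k ≤ Δ → ∃ w : V, G.Adj r w ∧ redCount G c w = k)) :
    ∃ c' : G.edgeSet → Bool,
      ∀ φ : G ≃g G, (∀ e : G.edgeSet, c' (φ.mapEdgeSet e) = c' e) → ∀ v : V, φ v = v := by
  obtain ⟨c, hfix, hred, hcount⟩ := hc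
  by_cases hψ : ∃ ψ : G ≃g G, Preserves c ψ ∧ ψ r ≠ r
  swap
  · exact ⟨c, fun φ hφ => hfix φ (by_contra fun h => hψ ⟨φ, hφ, h⟩) hφ⟩
  obtain ⟨ψ, hψ, hψr⟩ := hψ
  have hr : r ∈ allRedVertices G c := by
    rcases hred with h | ⟨x, -, h⟩ <;> simp [h]
  have hψmem : ψ r ∈ allRedVertices G c := by
    rw [← redCount_eq_iff_mem_allRedVertices hreg, hψ.redCount_apply,
      redCount_eq_iff_mem_allRedVertices hreg]
    exact hr
  obtain ⟨x, hrx, hred⟩ := hred.resolve_left fun h => hψr (by simpa [h] using hψmem)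
  have hψx : ψ r = x := by
    rw [hred] at hψmem
    exact hψmem.resolve_left hψr
  replace hcount := hcount ⟨x, hrx, hred⟩
  have hinj := redCount_injOn_neighborSet hreg hr hcount
  obtain ⟨z, hz, hcz⟩ := hcount (Δ - 1) (by omega) (by omega)
  have hy : ∀ v, G.Adj x v → redCount G c v + 1 = Δ → v = ψ z := by
    intro v hv hcv
    obtain ⟨v, rfl⟩ := ψ.surjective v
    rw [← hψx, ψ.map_adj_iff] at hv
    rw [hψ.redCount_apply] at hcv
    rw [hinj hv hz (by omega)]
  have hblue := redCount_add_ncard_blue (c := c) hreg (ψ z)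
  rw [hψ.redCount_apply] at hblue
  obtain ⟨y', hy'⟩ := Set.ncard_eq_one.mp
    (show {u | G.Adj (ψ z) u ∧ ¬ Red c (ψ z) u}.ncard = 1 by omega)
  obtain ⟨k, hk1, hk3, hk, hk'⟩ : ∃ k, 1 ≤ k ∧ k ≤ 3 ∧
      k ≠ redCount G c y' ∧ k ≠ redCount G c y' + 1 := by
    by_cases h1 : redCount G c y' ≤ 1
    · exact ⟨3, by omega⟩
    · exact ⟨1, by omega⟩
  obtain ⟨w, hrw, rfl⟩ := hcount k hk1 (by omega)
  have hwx : w ≠ x := by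
    rintro rfl
    have := (redCount_eq_iff_mem_allRedVertices (c := c) hreg (v := w)).mpr (by simp [hred])
    omega
  refine ⟨recolour c r w, fun φ hφ => ?_⟩
  obtain ⟨hφr, hφw⟩ := Preserves.fixes_of_recolour hreg hred hrx hrw hwx hy
    (fun u hu hu' => (Set.ext_iff.mp hy' u).mp ⟨hu, hu'⟩) hk hk' hφ
  exact hfix φ hφr (Preserves.of_recolour hφ hφr hφw)
end

section
/- Let G be a simple graph, r a vertex of G, and c an edge colouring of G with colours red and blue such that every edge incident to r is red and the only automorphism of G fixing r and preserving c is the identity. Then for any neighbour s of r, the colouring c' obtained from c by recolouring the single edge rs to blue (and leaving all other edges unchanged) again has the property that the only automorphism of G fixing r and preserving c' is the identity. -/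
open SimpleGraph

/-- If every edge incident to `r` is red (`true` = red, `false` = blue) and `c` is preserved
only by the trivial automorphism among those fixing `r`, then recolouring the single edge
`rs` (to a neighbour `s` of `r`) blue yields a colouring with the same property. -/
theorem stmt_6 {V : Type*} (G : SimpleGraph V) (r s : V) (hadj : G.Adj r s)
    (c : G.edgeSet → Bool)
    (hred : ∀ e : G.edgeSet, r ∈ (e : Sym2 V) → c e = true)
    (hdist : ∀ φ : G ≃g G, φ r = r →
      (∀ e : G.edgeSet, c (φ.mapEdgeSet e) = c e) → ∀ v : V, φ v = v) :
    ∀ c' : G.edgeSet → Bool,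
      (∀ e : G.edgeSet,
        ((e : Sym2 V) = s(r, s) → c' e = false) ∧
        ((e : Sym2 V) ≠ s(r, s) → c' e = c e)) →
      ∀ φ : G ≃g G, φ r = r →
        (∀ e : G.edgeSet, c' (φ.mapEdgeSet e) = c' e) → ∀ v : V, φ v = v := by
  intro c' hc' φ hφ hpres
  refine hdist φ hφ fun e => ?_
  have hmem : r ∈ (φ.mapEdgeSet e : Sym2 V) ↔ r ∈ (e : Sym2 V) := by
    change r ∈ Sym2.map φ (e : Sym2 V) ↔ _
    rw [Sym2.mem_map]
    refine ⟨?_, fun h => ⟨r, h, hφ⟩⟩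
    rintro ⟨a, ha, har⟩
    rwa [← φ.injective (har.trans hφ.symm)]
  by_cases hr : r ∈ (e : Sym2 V)
  · rw [hred _ hr, hred _ (hmem.2 hr)]
  · have hne : ∀ f : G.edgeSet, r ∉ (f : Sym2 V) → c' f = c f := fun f hf =>
      (hc' f).2 fun h => hf (h ▸ Sym2.mem_mk_left r s)
    rw [← hne e hr, ← hne _ (mt hmem.1 hr), hpres]
end

section
/- Let Δ ≥ 4 be a natural number, let G be a connected locally finite Δ-regular simple graph, let r be a vertex, and let c be an edge colouring of G with colours red and blue such that: the only automorphism of G fixing r and preserving c is the identity; there is a neighbour x of r such that the set of vertices all of whose incident edges are red is exactly {r, x}; y is the unique neighbour of x with exactly one incident blue edge; and y is adjacent to r. Then the colouring c' obtained from c by recolouring the edge ry to blue is a distinguishing colouring of G, i.e. the only automorphism of G preserving c' is the identity. -/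
open SimpleGraph

/-- The number of blue edges incident to a vertex `v`, for an edge colouring
`c : G.edgeSet → Bool`, where `true` stands for red and `false` for blue. -/
noncomputable def blueCount {V : Type*} (G : SimpleGraph V) (c : G.edgeSet → Bool) (v : V) : ℕ :=
  Set.ncard {u : V | ∃ h : G.Adj v u, c ⟨s(v, u), (G.mem_edgeSet).mpr h⟩ = false}

/-- The vertices joined to `v` by a blue edge. -/
def blueNeighbors {V : Type*} (G : SimpleGraph V) (c : G.edgeSet → Bool) (v : V) : Set V :=
  {u : V | ∃ h : G.Adj v u, c ⟨s(v, u), (G.mem_edgeSet).mpr h⟩ = false}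

lemma mem_allRedVertices_iff {V : Type*} {G : SimpleGraph V} {c : G.edgeSet → Bool} {v : V} :
    v ∈ allRedVertices G c ↔ blueNeighbors G c v = ∅ := by
  rw [Set.eq_empty_iff_forall_notMem]
  constructor
  · rintro h u ⟨ha, hu⟩
    have := h ⟨s(v, u), (G.mem_edgeSet).mpr ha⟩ (Sym2.mem_mk_left v u)
    simp_all
  · rintro h ⟨e, he⟩ hv
    obtain ⟨u, rfl⟩ := Sym2.mem_iff_exists.mp hv
    by_contra hc
    exact h u ⟨(G.mem_edgeSet).mp he, by simpa using hc⟩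

lemma map_mem_blueNeighbors_iff {V : Type*} {G : SimpleGraph V} {c : G.edgeSet → Bool}
    {φ : G ≃g G} (hφ : ∀ e : G.edgeSet, c (φ.mapEdgeSet e) = c e) {v u : V} :
    φ u ∈ blueNeighbors G c (φ v) ↔ u ∈ blueNeighbors G c v := by
  constructor
  · rintro ⟨h, hc⟩
    exact ⟨φ.map_adj_iff.mp h, (hφ ⟨s(v, u), φ.map_adj_iff.mp h⟩).symm.trans hc⟩
  · rintro ⟨h, hc⟩
    exact ⟨φ.map_adj_iff.mpr h, (hφ ⟨s(v, u), h⟩).trans hc⟩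

lemma image_blueNeighbors {V : Type*} {G : SimpleGraph V} {c : G.edgeSet → Bool}
    {φ : G ≃g G} (hφ : ∀ e : G.edgeSet, c (φ.mapEdgeSet e) = c e) (v : V) :
    φ '' blueNeighbors G c v = blueNeighbors G c (φ v) := by
  ext w
  obtain ⟨u, rfl⟩ := φ.surjective w
  rw [φ.injective.mem_set_image, map_mem_blueNeighbors_iff hφ]

/-- Case 1 of the proof of the main theorem: with `c` as in Claim 5 where the all-red
vertices are exactly `{r, x}` for a neighbour `x` of `r`, and `y` the unique neighbour
of `x` with exactly one incident blue edge, if `y` is adjacent to `r`, then recolouring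
the edge `ry` blue yields a distinguishing colouring of `G`. -/
theorem stmt_7 {V : Type*} (G : SimpleGraph V) [G.LocallyFinite]
    (Δ : ℕ) (hΔ : 4 ≤ Δ) (hconn : G.Connected) (hreg : G.IsRegularOfDegree Δ)
    (r x y : V) (c : G.edgeSet → Bool)
    (hdist : ∀ φ : G ≃g G, φ r = r →
      (∀ e : G.edgeSet, c (φ.mapEdgeSet e) = c e) → ∀ v : V, φ v = v)
    (hx : G.Adj r x) (hredset : allRedVertices G c = {r, x})
    (hxy : G.Adj x y) (hy : blueCount G c y = 1)
    (hyuniq : ∀ y' : V, G.Adj x y' → blueCount G c y' = 1 → y' = y)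
    (hry : G.Adj r y) :
    ∀ c' : G.edgeSet → Bool,
      (∀ e : G.edgeSet,
        ((e : Sym2 V) = s(r, y) → c' e = false) ∧
        ((e : Sym2 V) ≠ s(r, y) → c' e = c e)) →
      ∀ φ : G ≃g G, (∀ e : G.edgeSet, c' (φ.mapEdgeSet e) = c' e) → ∀ v : V, φ v = v := by
  intro c' hc' φ hφ
  have blue_iff : ∀ v u, u ∈ blueNeighbors G c' v ↔
      u ∈ blueNeighbors G c v ∨ s(v, u) = s(r, y) := by
    intro v u
    by_cases he : s(v, u) = s(r, y)
    · have ha : G.Adj v u := by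
        rw [← G.mem_edgeSet, he]
        exact hry
      exact iff_of_true ⟨ha, (hc' ⟨s(v, u), ha⟩).1 he⟩ (Or.inr he)
    · simp only [he, or_false]
      exact exists_congr fun h => by rw [(hc' ⟨s(v, u), h⟩).2 he]
  have hr_c : blueNeighbors G c r = ∅ := mem_allRedVertices_iff.mp (by simp [hredset])
  have hx_c : blueNeighbors G c x = ∅ := mem_allRedVertices_iff.mp (by simp [hredset])
  have hr_c' : blueNeighbors G c' r = {y} := by
    ext u
    simp [blue_iff, hr_c, hry.ne]
  have blue_eq : ∀ v, v ≠ r → v ≠ y → blueNeighbors G c' v = blueNeighbors G c v := by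
    intro v hvr hvy
    ext u
    simp [blue_iff, hvr, hvy]
  have hx_c' : blueNeighbors G c' x = ∅ := by rw [blue_eq x hx.ne' hxy.ne, hx_c]
  have hφx : φ x = x := by
    have hempty : blueNeighbors G c' (φ x) = ∅ := by
      rw [← image_blueNeighbors hφ, hx_c', Set.image_empty]
    have hne_r : φ x ≠ r := by
      intro h
      simp [h, hr_c'] at hempty
    have hne_y : φ x ≠ y := by
      intro h
      have : r ∈ blueNeighbors G c' (φ x) := (blue_iff _ _).mpr (Or.inr (by rw [h, Sym2.eq_swap]))
      simp [hempty] at this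
    rw [blue_eq _ hne_r hne_y, ← mem_allRedVertices_iff, hredset] at hempty
    exact hempty.resolve_left hne_r
  have hφr_blue : blueNeighbors G c' (φ r) = {φ y} := by
    rw [← image_blueNeighbors hφ, hr_c', Set.image_singleton]
  have hφr : φ r = r := by
    have hne_y : φ r ≠ y := by
      intro h
      rw [h] at hφr_blue
      obtain ⟨z, hz⟩ : ∃ z, blueNeighbors G c y = {z} := Set.ncard_eq_one.mp hy
      have hz_mem : z ∈ blueNeighbors G c y := by simp [hz]
      have hzy : z = φ y := by
        have : z ∈ blueNeighbors G c' y := (blue_iff _ _).mpr (Or.inl hz_mem)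
        simpa [hφr_blue] using this
      have hry' : r = φ y := by
        have : r ∈ blueNeighbors G c' y := (blue_iff _ _).mpr (Or.inr Sym2.eq_swap)
        simpa [hφr_blue] using this
      rw [hzy, ← hry'] at hz_mem
      obtain ⟨h, hb⟩ := hz_mem
      have hred : r ∈ allRedVertices G c := mem_allRedVertices_iff.mpr hr_c
      have := hred ⟨s(y, r), h⟩ (Sym2.mem_mk_right y r)
      simp_all
    by_contra hne_r
    rw [blue_eq _ hne_r hne_y] at hφr_blue
    refine hne_y (hyuniq _ ?_ (Set.ncard_eq_one.mpr ⟨_, hφr_blue⟩))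
    rw [← hφx]
    exact φ.map_adj_iff.mpr hx.symm
  have hφy : φ y = y := by
    rw [hφr, hr_c'] at hφr_blue
    exact (Set.singleton_injective hφr_blue).symm
  refine hdist φ hφr fun e => ?_
  have map_edge : (φ.mapEdgeSet e : Sym2 V) = Sym2.map φ e := rfl
  have map_ry : Sym2.map φ s(r, y) = s(r, y) := by rw [Sym2.map_mk, hφr, hφy]
  by_cases he : (e : Sym2 V) = s(r, y)
  · congr 1
    exact Subtype.ext (by rw [map_edge, he, map_ry])
  · have he' : (φ.mapEdgeSet e : Sym2 V) ≠ s(r, y) := by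
      rw [map_edge, ← map_ry]
      exact fun h => he (Sym2.map.injective φ.injective h)
    rw [← (hc' _).2 he', ← (hc' _).2 he, hφ]
end
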